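/- arXiv:1412.7290 — 3 statements merged into one kernel-verified Lean document; each statement's English description precedes it below -/
import Mathlib

section
/- Let C be an entry-faithful (X,2)-neighbour transitive code in H(m,q) with minimum distance δ ≥ 5 and |C| ≥ 2, where the image of X under the entry-action homomorphism μ : X → S_m is the alternating group Alt(M) or the symmetric group Sym(M). Then q = 2, C is equivalent to the binary repetition code Rep(m,2), and μ(X) = Sym(M) (so X ≅ S_m). -/
open Equiv

namespace NT

/-- Vertices of the Hamming graph `H(m,q)`. -/
abbrev V (m q : ℕ) := Fin m → Fin q

/-- The automorphism of `H(m,q)` determined by alphabet permutations `g` and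
an entry permutation `σ`:  `α ↦ (i ↦ gᵢ (α (σ⁻¹ i)))`. -/
def hAut (m q : ℕ) (g : Fin m → Perm (Fin q)) (σ : Perm (Fin m)) :
    Perm (V m q) where
  toFun α := fun i => g i (α (σ⁻¹ i))
  invFun α := fun i => (g (σ i))⁻¹ (α (σ i))
  left_inv α := by funext i; simp
  right_inv α := by funext i; simp

/-- The automorphism group of the Hamming graph, as a subgroup of the group of
all permutations of the vertex set:  `S_q^m ⋊ S_m`. -/
def HammingAut (m q : ℕ) : Subgroup (Perm (V m q)) where
  carrier := {x | ∃ g σ, x = hAut m q g σ}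
  one_mem' := ⟨fun _ => 1, 1, by ext α i; simp [hAut]⟩
  mul_mem' := by
    rintro x y ⟨g, σ, rfl⟩ ⟨h, τ, rfl⟩
    exact ⟨fun i => g i * h (σ⁻¹ i), σ * τ, by ext α i; simp [hAut, Perm.mul_apply]⟩
  inv_mem' := by
    rintro x ⟨g, σ, rfl⟩
    refine ⟨fun i => (g (σ i))⁻¹, σ⁻¹, ?_⟩
    ext α i
    simp [hAut, Perm.inv_def]

/-- The minimum distance of a code `C ⊆ H(m,q)`. -/
noncomputable def minDist (m q : ℕ) (C : Set (V m q)) : ℕ :=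
  sInf {d | ∃ α ∈ C, ∃ β ∈ C, α ≠ β ∧ hammingDist α β = d}

/-- The distance `d(α, C)` from a vertex to a code. -/
noncomputable def distTo (m q : ℕ) (C : Set (V m q)) (α : V m q) : ℕ :=
  sInf {d | ∃ β ∈ C, hammingDist α β = d}

/-- `C_r`, the set of vertices at distance exactly `r` from the code `C`. -/
def cell (m q : ℕ) (C : Set (V m q)) (r : ℕ) : Set (V m q) :=
  {α | distTo m q C α = r}

/-- The covering radius of a code. -/
noncomputable def covRad (m q : ℕ) (C : Set (V m q)) : ℕ :=
  sSup (Set.range (distTo m q C))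

/-- `S` is an orbit of the subgroup `X ≤ Sym(V)`. -/
def IsOrbit (m q : ℕ) (X : Subgroup (Perm (V m q))) (S : Set (V m q)) : Prop :=
  S.Nonempty ∧ (∀ x ∈ X, ∀ ν ∈ S, x ν ∈ S) ∧
    ∀ ν ∈ S, ∀ μ ∈ S, ∃ x ∈ X, x ν = μ

/-- `C` is `(X,s)`-neighbour transitive:  `X` is a group of automorphisms of the
Hamming graph and each of `C, C_1, …, C_s` is an `X`-orbit. -/
def IsNT (m q : ℕ) (X : Subgroup (Perm (V m q))) (C : Set (V m q)) (s : ℕ) : Prop :=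
  X ≤ HammingAut m q ∧ IsOrbit m q X C ∧
    ∀ i, 1 ≤ i → i ≤ s → IsOrbit m q X (cell m q C i)

/-- `X` acts faithfully on the set of entries, i.e. `X ∩ S_q^m = 1`. -/
def EntryFaithful (m q : ℕ) (X : Subgroup (Perm (V m q))) : Prop :=
  ∀ x ∈ X, (∃ g, x = hAut m q g 1) → x = 1

/-- The image of `X` in `S_m` under the entry action `μ`. -/
def entryImage (m q : ℕ) (X : Subgroup (Perm (V m q))) : Set (Perm (Fin m)) :=
  {σ | ∃ x ∈ X, ∃ g, x = hAut m q g σ}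

/-- Two codes are equivalent if one is the image of the other under an
automorphism of the Hamming graph. -/
def CodeEquiv (m q : ℕ) (C C' : Set (V m q)) : Prop :=
  ∃ x ∈ HammingAut m q, x '' C = C'

/-- The repetition code: all constant tuples. -/
def RepCode (m q : ℕ) : Set (V m q) := {α | ∃ a, α = fun _ => a}

/-- The zero vertex. -/
def zeroV (m q : ℕ) [NeZero q] : V m q := fun _ => 0

/-- The weight of a vertex: the number of nonzero entries. -/
noncomputable def wt (m q : ℕ) [NeZero q] (α : V m q) : ℕ :=
  hammingNorm α

/-- `α` covers `ν` if `α` agrees with `ν` on every nonzero entry of `ν`. -/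
def Covers (m q : ℕ) [NeZero q] (α ν : V m q) : Prop :=
  ∀ i, ν i ≠ 0 → ν i = α i

/-- A `q`-ary `s-(m,k,λ)` design: a set of weight-`k` vertices such that every
weight-`s` vertex is covered by exactly `λ` of them. -/
noncomputable def IsDesign (m q : ℕ) [NeZero q] (s k lam : ℕ) (D : Set (V m q)) : Prop :=
  (∀ α ∈ D, wt m q α = k) ∧
    ∀ ν : V m q, wt m q ν = s → {α ∈ D | Covers m q α ν}.ncard = lam

/-- `C` is `s`-regular: for each `i ≤ s` and `k ≤ m`, the number
`|Γ_k(ν) ∩ C|` is the same for all `ν ∈ C_i`. -/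
def SRegular (m q : ℕ) (C : Set (V m q)) (s : ℕ) : Prop :=
  ∀ i ≤ s, ∀ k ≤ m, ∀ ν ∈ cell m q C i, ∀ μ ∈ cell m q C i,
    {β ∈ C | hammingDist ν β = k}.ncard = {β ∈ C | hammingDist μ β = k}.ncard

/-- The automorphism group of a code: the setwise stabiliser of `C` in the
automorphism group of the Hamming graph. -/
def AutCode (m q : ℕ) (C : Set (V m q)) : Subgroup (Perm (V m q)) where
  carrier := {x | x ∈ HammingAut m q ∧ x '' C = C}
  one_mem' := ⟨(HammingAut m q).one_mem, by simp⟩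
  mul_mem' := by
    rintro x y ⟨hx, hx'⟩ ⟨hy, hy'⟩
    exact ⟨mul_mem hx hy, by rw [Perm.coe_mul, Set.image_comp, hy', hx']⟩
  inv_mem' := by
    rintro x ⟨hx, hx'⟩
    refine ⟨inv_mem hx, ?_⟩
    conv_lhs => rw [← hx']
    rw [← Set.image_comp]
    simp [Perm.inv_def]

/-- `N` is a minimal normal subgroup of the (sub)group `H`. -/
def IsMinNormalIn {G : Type*} [Group G] (H N : Subgroup G) : Prop :=
  N ≤ H ∧ N ≠ ⊥ ∧ (∀ h ∈ H, ∀ n ∈ N, h * n * h⁻¹ ∈ N) ∧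
    ∀ K : Subgroup G, K ≤ H → K ≠ ⊥ →
      (∀ h ∈ H, ∀ k ∈ K, h * k * h⁻¹ ∈ K) → K ≤ N → K = N

/-- The socle of a subgroup `H`: the subgroup generated by all minimal
normal subgroups of `H`. -/
def socleIn {G : Type*} [Group G] (H : Subgroup G) : Subgroup G :=
  ⨆ N ∈ {N : Subgroup G | IsMinNormalIn H N}, N

/-- A row of the punctured Hadamard 12 code: the binary vector whose entry at
`a ∈ F₁₁` is `1` exactly when `a - b` is a square in `F₁₁` (including `0`),
corresponding to the translate by `b` of the first row of the normalised Paley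
Hadamard matrix of order 12 (with the `*` coordinate deleted, and with the
Hadamard entry `-1` encoded as `1`, `1` as `0`). -/
def hadRow (b : ZMod 11) : V 11 2 :=
  fun i => if ∃ c : ZMod 11, c ^ 2 = ((i : ℕ) : ZMod 11) - b then 1 else 0

/-- The punctured Hadamard code of length 12 in `H(11,2)`: the zero vector and
all-ones vector (from the all-`(-1)` row of `-H₁₂` and of `H₁₂`), the eleven
weight-6 rows `hadRow b`, and their complements (the rows of `-H₁₂`). -/
def PHad : Set (V 11 2) :=
  {(fun _ => 0), (fun _ => 1)} ∪ Set.range hadRow ∪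
    Set.range (fun b => (fun i => 1 - hadRow b i : V 11 2))

/-- The even weight subcode of the punctured Hadamard code of length 12: the
zero vector together with the eleven weight-6 codewords. -/
def ESub : Set (V 11 2) :=
  insert (fun _ => 0) (Set.range hadRow)

end NT

namespace NT

section Cycles

variable {α : Type*} [DecidableEq α]

/-- The 3-cycle `a ↦ b ↦ c ↦ a`, if `a`, `b`, `c` are distinct. -/
def c3 (a b c : α) : Perm α := swap a b * swap b c

theorem c3_conj (σ : Perm α) (a b c : α) : σ * c3 a b c * σ⁻¹ = c3 (σ a) (σ b) (σ c) := by
  simp only [c3, swap_apply_apply]; group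

theorem c3_apply {a b c : α} (hab : a ≠ b) (hac : a ≠ c) (hbc : b ≠ c) (x : α) :
    c3 a b c x = if x = a then b else if x = b then c else if x = c then a else x := by
  simp only [c3, Perm.mul_apply, swap_apply_def]
  split_ifs <;> simp_all

theorem c3_rot {a b c : α} (hab : a ≠ b) (hac : a ≠ c) (hbc : b ≠ c) : c3 a b c = c3 b c a := by
  ext x
  rw [c3_apply hab hac hbc, c3_apply hbc hab.symm hac.symm]
  split_ifs <;> simp_all

theorem c3_inv {a b c : α} (hab : a ≠ b) (hac : a ≠ c) (hbc : b ≠ c) : (c3 a b c)⁻¹ = c3 b a c := by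
  rw [inv_eq_iff_mul_eq_one]
  ext x
  rw [Perm.mul_apply, c3_apply hab.symm hbc hac, c3_apply hab hac hbc, Perm.one_apply]
  split_ifs <;> simp_all

theorem c3_commutator {a b c d : α} (hab : a ≠ b) (hac : a ≠ c) (had : a ≠ d) (hbc : b ≠ c)
    (hbd : b ≠ d) (hcd : c ≠ d) :
    c3 a b c * c3 a b d * (c3 a b c)⁻¹ * (c3 a b d)⁻¹ = swap a b * swap c d := by
  rw [c3_inv hab hac hbc, c3_inv hab had hbd]
  ext x
  simp only [Perm.mul_apply, c3_apply hab hac hbc, c3_apply hab had hbd, 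
    c3_apply hab.symm hbc hac, c3_apply hab.symm hbd had, swap_apply_def]
  grind

theorem c3_rot' {a b c : α} (hab : a ≠ b) (hac : a ≠ c) (hbc : b ≠ c) : c3 a b c = c3 c a b := by
  rw [c3_rot hab hac hbc, c3_rot hbc hab.symm hac.symm]

theorem swap_mul_swap_mul {a b c d : α} (e : α) (hac : a ≠ c) (had : a ≠ d)
    (hbc : b ≠ c) (hbd : b ≠ d) :
    (swap a b * swap c d) * (swap a b * swap d e) = c3 c d e := by
  have h : swap a b * (swap c d * swap a b) = swap c d := by
    have := swap_apply_apply (swap a b) c d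
    rw [swap_apply_of_ne_of_ne hac.symm hbc.symm, swap_apply_of_ne_of_ne had.symm hbd.symm,
      swap_inv] at this
    rw [← mul_assoc, ← this]
  rw [mul_assoc, ← mul_assoc (swap c d), ← mul_assoc (swap a b), h, c3]

theorem commutator_eq_c3 {x y : Perm α} {p : α} (hx : x p ≠ p) (hy : y p ≠ p)
    (hxy : ∀ w, w ≠ p → x w = w ∨ y w = w) :
    x * y * x⁻¹ * y⁻¹ = c3 p (x p) (y p) ∧ x p ≠ y p := by
  have e1 : y (x p) = x p := (hxy _ hx).resolve_left fun h => hx (x.injective h)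
  have e2 : x (y p) = y p := (hxy _ hy).resolve_right fun h => hy (y.injective h)
  have hne : x p ≠ y p := by
    intro h
    rw [h] at e1
    exact hy (y.injective e1)
  refine ⟨?_, hne⟩
  rw [mul_inv_eq_iff_eq_mul, mul_inv_eq_iff_eq_mul]
  ext w
  simp only [Perm.mul_apply, c3_apply hx.symm hy.symm hne]
  by_cases hw : w = p
  · subst hw
    rw [e1, if_neg hx, if_pos rfl, e2]
  by_cases hxw : x w = w
  · by_cases hyw : y w = p
    · rw [hxw, hyw, if_pos rfl]
    · have h1 : y w ≠ x p := by
        intro h; rw [← e1] at h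
        have := y.injective h
        exact hw (x.injective (hxw.trans this))
      have h2 : y w ≠ y p := fun h => hw (y.injective h)
      rw [hxw, if_neg hyw, if_neg h1, if_neg h2]
      by_cases hyy : y w = w
      · rw [hyy, hxw]
      · exact (hxy _ hyw).resolve_right fun h => hyy (y.injective h)
  · have hyw := (hxy w hw).resolve_left hxw
    by_cases hxwp : x w = p
    · rw [hyw, hxwp]
      have h1 : y p ≠ x p := hne.symm
      rw [if_neg hy, if_neg h1, if_pos rfl]
    · have h3 : y (x w) = x w := (hxy _ hxwp).resolve_left fun h => hxw (x.injective h)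
      have h1 : x w ≠ x p := fun h => hw (x.injective h)
      have h2 : x w ≠ y p := by
        intro h
        rw [← e2] at h
        have := x.injective h
        subst this
        exact hy (y.injective hyw)
      rw [hyw, h3, if_neg hxwp, if_neg h1, if_neg h2]

/-- The points `i` and `j` are equal or lie in a common 3-cycle of `W`. -/
def Linked (W : Subgroup (Perm α)) (i j : α) : Prop :=
  i = j ∨ ∃ k, i ≠ j ∧ i ≠ k ∧ j ≠ k ∧ c3 i j k ∈ W

theorem Linked.symm {W : Subgroup (Perm α)} {i j : α} (h : Linked W i j) : Linked W j i := by
  obtain rfl | ⟨k, h1, h2, h3, h⟩ := h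
  · exact Or.inl rfl
  · refine Or.inr ⟨k, h1.symm, h3, h2, ?_⟩
    rw [← c3_inv h1 h2 h3]
    exact W.inv_mem h

theorem c3_conj_mem {W : Subgroup (Perm α)} {σ : Perm α} {a b c : α} (hσ : σ ∈ W)
    (h : c3 a b c ∈ W) : c3 (σ a) (σ b) (σ c) ∈ W := by
  rw [← c3_conj]
  exact W.mul_mem (W.mul_mem hσ h) (W.inv_mem hσ)

theorem Linked.map {W : Subgroup (Perm α)} {σ : Perm α} {i j : α} (hσ : σ ∈ W)
    (h : Linked W i j) : Linked W (σ i) (σ j) := by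
  obtain rfl | ⟨k, h1, h2, h3, h⟩ := h
  · exact Or.inl rfl
  · exact Or.inr ⟨σ k, by simpa, by simpa, by simpa, c3_conj_mem hσ h⟩

theorem Linked.trans {W : Subgroup (Perm α)} {i j l : α} (h : Linked W i j) (h' : Linked W j l) :
    Linked W i l := by
  obtain rfl | ⟨k, h1, h2, h3, h⟩ := h
  · exact h'
  obtain rfl | ⟨r, g1, g2, g3, g⟩ := h'
  · exact Or.inr ⟨k, h1, h2, h3, h⟩
  by_cases hil : i = l
  · exact Or.inl hil
  by_cases hlk : l = k
  · subst hlk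
    refine Linked.symm (Or.inr ⟨j, Ne.symm hil, h3.symm, h1, ?_⟩)
    rwa [← c3_rot' h1 h2 h3]
  by_cases hri : r = i
  · subst hri
    refine Linked.symm (Or.inr ⟨j, Ne.symm hil, g1.symm, h1, ?_⟩)
    rwa [← c3_rot g1 g2 g3]
  have e1 : (c3 i j k)⁻¹ j = i := by
    rw [Perm.inv_eq_iff_eq, c3_apply h1 h2 h3]; simp
  have e2 : (c3 i j k)⁻¹ l = l := by
    rw [Perm.inv_eq_iff_eq, c3_apply h1 h2 h3]; simp [g1.symm, hlk, Ne.symm hil]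
  have := Linked.map (W.inv_mem h) (Or.inr ⟨r, g1, g2, g3, g⟩ : Linked W j l)
  rwa [e1, e2] at this

theorem c3_mem_of_linked {W : Subgroup (Perm α)} {a b c : α} (hab : a ≠ b) (hac : a ≠ c)
    (hbc : b ≠ c) (h : Linked W a b) (h' : Linked W a c) : c3 a b c ∈ W := by
  obtain rfl | ⟨r, -, har, hbr, h⟩ := h
  · exact absurd rfl hab
  by_cases hrc : r = c
  · rwa [← hrc]
  have hra : Linked W r a := Or.inr ⟨b, har.symm, hbr.symm, hab, by rwa [← c3_rot' hab har hbr]⟩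
  obtain rfl | ⟨s, -, hrs, hcs, g⟩ := hra.trans h'
  · exact absurd rfl hrc
  have key := c3_conj_mem g h
  have key' := W.inv_mem (c3_conj_mem (W.inv_mem g) h)
  rw [c3_inv hrc hrs hcs] at key'
  simp only [c3_apply hrc hrs hcs] at key
  simp only [c3_apply (Ne.symm hrc) hcs hrs, if_neg hac, if_neg har, if_neg hbc, if_neg hbr,
    if_true, if_neg hrc] at key'
  by_cases has : a = s
  · subst has
    simp only [if_true, if_neg hab.symm] at key'
    rwa [c3_inv hbc.symm hac.symm hab.symm, c3_rot' hbc hab.symm hac.symm] at key'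
  by_cases hbs : b = s
  · subst hbs
    simp only [if_true, if_neg hab] at key'
    rwa [c3_inv hac hab hbc.symm, c3_rot hac.symm hbc.symm hab] at key'
  simpa [har, hac, has, hbr, hbc, hbs] using key

/-- If `W` contains a 3-cycle, but not every 3-cycle avoiding its fixed point `i₀`, then some
3-cycle `t = (a b c)` outside `W` is such that `W ∩ t W t⁻¹` maps `a` into `{a, c}`. -/
theorem exists_c3_almost_fixed {W : Subgroup (Perm α)} {i₀ : α}
    (hW : ∃ a b c, a ≠ b ∧ a ≠ c ∧ b ≠ c ∧ c3 a b c ∈ W)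
    (hW' : ∃ a b c, a ≠ b ∧ a ≠ c ∧ b ≠ c ∧ a ≠ i₀ ∧ b ≠ i₀ ∧ c ≠ i₀ ∧ c3 a b c ∉ W)
    (hfix : ∀ σ ∈ W, σ i₀ = i₀) :
    ∃ a b c, a ≠ b ∧ a ≠ c ∧ b ≠ c ∧ a ≠ i₀ ∧ b ≠ i₀ ∧ c ≠ i₀ ∧ c3 a b c ∉ W ∧
      ∀ σ ∈ W, (c3 a b c)⁻¹ * σ * c3 a b c ∈ W → σ a = a ∨ σ a = c := by
  obtain ⟨a, b, r, hab, har, hbr, h⟩ := hW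
  have h0 := hfix _ h
  rw [c3_apply hab har hbr] at h0
  have ha : a ≠ i₀ := by rintro rfl; simp [hab.symm] at h0
  have hb : b ≠ i₀ := by rintro rfl; simp [hab.symm, hbr.symm] at h0
  have hLab : Linked W a b := Or.inr ⟨r, hab, har, hbr, h⟩
  have hLbr : Linked W b r := Or.inr ⟨a, hbr, hab.symm, har.symm, by rwa [← c3_rot hab har hbr]⟩
  have hLar := hLab.trans hLbr
  have hc : ∃ c, c ≠ i₀ ∧ ¬ Linked W a c := by
    by_contra! hcon
    obtain ⟨x, y, z, hxy, hxz, hyz, hx, hy, hz, hn⟩ := hW'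
    exact hn (c3_mem_of_linked hxy hxz hyz ((hcon x hx).symm.trans (hcon y hy))
      ((hcon x hx).symm.trans (hcon z hz)))
  obtain ⟨c, hc, hnac⟩ := hc
  have hac : a ≠ c := fun h => hnac (Or.inl h)
  have hbc : b ≠ c := by rintro rfl; exact hnac hLab
  have hrc : r ≠ c := by rintro rfl; exact hnac hLar
  refine ⟨a, b, c, hab, hac, hbc, ha, hb, hc, fun h => ?_, fun σ hσ hσt => ?_⟩
  · exact hnac (Linked.symm (Or.inr ⟨b, hac.symm, hbc.symm, hab, by rwa [← c3_rot' hab hac hbc]⟩))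
  set t := c3 a b c with ht
  have hta : t⁻¹ a = c := by
    rw [Perm.inv_eq_iff_eq, ht, c3_apply hab hac hbc]
    simp [hac.symm, hbc.symm]
  have htb : t⁻¹ b = a := by rw [Perm.inv_eq_iff_eq, ht, c3_apply hab hac hbc]; simp
  have htc : t⁻¹ c = b := by rw [Perm.inv_eq_iff_eq, ht, c3_apply hab hac hbc]; simp [hab.symm]
  have hto : ∀ w, w ≠ a → w ≠ b → w ≠ c → t⁻¹ w = w := by
    intro w h1 h2 h3
    rw [Perm.inv_eq_iff_eq, ht, c3_apply hab hac hbc]; simp [h1, h2, h3]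
  have hiso : ∀ y, Linked W a y → Linked W (t⁻¹ a) (t⁻¹ y) → y = a := by
    intro y hy hy'
    by_contra hya
    rw [hta] at hy'
    by_cases hyb : y = b
    · rw [hyb, htb] at hy'
      exact hnac hy'.symm
    have hyc : y ≠ c := by rintro rfl; exact hnac hy
    rw [hto y hya hyb hyc] at hy'
    exact hnac (hy.trans hy'.symm)
  have hisoσ : ∀ y, Linked W (σ a) y → Linked W (t⁻¹ (σ a)) (t⁻¹ y) → y = σ a := by
    intro y hy hy'
    have h1 := hy.map (W.inv_mem hσ)
    have h2 := hy'.map (W.inv_mem hσt)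
    have e : ∀ z, (t⁻¹ * σ * t)⁻¹ (t⁻¹ z) = t⁻¹ (σ⁻¹ z) := fun z => by
      rw [← Perm.mul_apply, ← Perm.mul_apply]
      congr 1
      group
    have e' : σ⁻¹ (σ a) = a := σ.symm_apply_apply a
    rw [e, e, e'] at h2
    rw [e'] at h1
    exact Perm.inv_eq_iff_eq.mp (hiso _ h1 h2)
  by_contra! hcon
  obtain ⟨h1, h2⟩ := hcon
  have hσab := hLab.map hσ
  have hσar := hLar.map hσ
  have hσn : ∀ {u v}, u ≠ v → σ u ≠ σ v := fun h h' => h (σ.injective h')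
  by_cases h3 : σ a = b
  · have := hisoσ r (h3 ▸ hLbr) (by
      rw [h3, htb, hto r har.symm hbr.symm hrc]
      exact hLar)
    rw [h3] at this
    exact hbr this.symm
  have hmem : ∀ y, y ≠ σ a → Linked W (σ a) y → y = a ∨ y = b ∨ y = c := by
    intro y hy hL
    by_contra! hy'
    refine hy (hisoσ y hL ?_)
    rwa [hto _ h1 h3 h2, hto y hy'.1 hy'.2.1 hy'.2.2]
  have hnb : ¬ Linked W (σ a) b := fun hL => by
    have hLa := hL.trans hLab.symm
    refine h3 (hisoσ b hL ?_).symm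
    rwa [hto _ h1 h3 h2, htb]
  have hna : ¬ Linked W (σ a) a := fun hL => hnb (hL.trans hLab)
  have e1 := hmem _ (hσn hab.symm) hσab
  have e2 := hmem _ (hσn har.symm) hσar
  have f1 : σ b = c := by
    rcases e1 with e | e | e
    · exact absurd (e ▸ hσab) hna
    · exact absurd (e ▸ hσab) hnb
    · exact e
  have f2 : σ r = c := by
    rcases e2 with e | e | e
    · exact absurd (e ▸ hσar) hna
    · exact absurd (e ▸ hσar) hnb
    · exact e
  exact hbr (σ.injective (f1.trans f2.symm))

/-- Bochert's argument: either `W` contains a 3-cycle, or there is a large set of points `Δ` such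
that no nontrivial even element of `W` is supported in `Δ`. -/
theorem exists_c3_or_large_independent [Fintype α] (W : Subgroup (Perm α)) {i₀ : α} :
    (∃ a b c, a ≠ b ∧ a ≠ c ∧ b ≠ c ∧ c3 a b c ∈ W) ∨
    ∃ Δ : Finset α, i₀ ∉ Δ ∧ Fintype.card α ≤ 2 * Δ.card + 1 ∧
      ∀ σ ∈ W, Perm.sign σ = 1 → (∀ w, w ∉ Δ → σ w = w) → σ = 1 := by
  classical
  let F : Finset (Finset α) := Finset.univ.filter fun Δ => i₀ ∉ Δ ∧
    ∀ σ ∈ W, Perm.sign σ = 1 → (∀ w, w ∉ Δ → σ w = w) → σ = 1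
  have hF : F.Nonempty := ⟨∅, by simp [F, Perm.ext_iff]⟩
  obtain ⟨Δ, hΔ, hmax⟩ := F.exists_max_image Finset.card hF
  simp only [F, Finset.mem_filter, Finset.mem_univ, true_and] at hΔ hmax
  by_cases hc : Fintype.card α ≤ 2 * Δ.card + 1
  · exact Or.inr ⟨Δ, hΔ.1, hc, hΔ.2⟩
  left
  have big : ∀ Δ' : Finset α, i₀ ∉ Δ' → Δ.card < Δ'.card →
      ∃ σ ∈ W, Perm.sign σ = 1 ∧ σ ≠ 1 ∧ ∀ w, w ∉ Δ' → σ w = w := by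
    intro Δ' h0 hlt
    by_contra! hcon
    refine absurd (hmax Δ' ⟨h0, fun σ hσ hs1 hs => ?_⟩) (by omega)
    by_contra hne
    obtain ⟨w, hw, hw'⟩ := hcon σ hσ hs1 hne
    exact hw' (hs w hw)
  have hcard : ((insert i₀ Δ)ᶜ : Finset α).card = Fintype.card α - (Δ.card + 1) := by
    rw [Finset.card_compl, Finset.card_insert_of_notMem hΔ.1]
  obtain ⟨x, hxW, -, hx1, hx⟩ := big (insert i₀ Δ)ᶜ (by simp) (by omega)
  obtain ⟨p, hp⟩ : ∃ p, x p ≠ p := by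
    by_contra! h
    exact hx1 (Perm.ext h)
  have hpΔ : p ≠ i₀ ∧ p ∉ Δ := by
    by_contra h
    refine hp (hx p ?_)
    simp only [Finset.mem_compl, Finset.mem_insert, not_not]
    tauto
  obtain ⟨y, hyW, hys, hy1, hy⟩ := big (insert p Δ) (by simp [hΔ.1, hpΔ.1.symm])
    (by rw [Finset.card_insert_of_notMem hpΔ.2]; omega)
  have hyp : y p ≠ p := by
    intro h
    refine hy1 (hΔ.2 y hyW hys fun w hw => ?_)
    by_cases hwp : w = p
    · rw [hwp, h]
    · exact hy w (by simp [hwp, hw])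
  have hxy : ∀ w, w ≠ p → x w = w ∨ y w = w := by
    intro w hw
    by_cases hwΔ : w ∈ Δ
    · exact Or.inl (hx w (by simp [hwΔ]))
    · exact Or.inr (hy w (by simp [hw, hwΔ]))
  obtain ⟨h, hne⟩ := commutator_eq_c3 hp hyp hxy
  refine ⟨p, x p, y p, hp.symm, hyp.symm, hne, ?_⟩
  rw [← h]
  exact W.mul_mem (W.mul_mem (W.mul_mem hxW hyW) (W.inv_mem hxW)) (W.inv_mem hyW)

end Cycles

theorem seventeen_mul_factorial_le {d : ℕ} (hd : 7 ≤ d) :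
    17 * (2 * d - 1).factorial ≤ d.factorial ^ 3 := by
  induction d, hd using Nat.le_induction with
  | base => decide
  | succ d hd ih =>
    obtain ⟨e, he⟩ : ∃ e, 2 * d - 1 = e := ⟨_, rfl⟩
    have h1 : 2 * (d + 1) - 1 = e + 1 + 1 := by omega
    have h2 : e + 1 = 2 * d := by omega
    rw [he] at ih
    rw [h1, Nat.factorial_succ, Nat.factorial_succ, Nat.factorial_succ d, h2, mul_pow]
    have h3 : (2 * d + 1) * (2 * d) ≤ (d + 1) ^ 3 := by
      have : 7 * (d * d) ≤ d * (d * d) := Nat.mul_le_mul_right _ hd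
      nlinarith
    calc 17 * ((2 * d + 1) * (2 * d * e.factorial))
        = ((2 * d + 1) * (2 * d)) * (17 * e.factorial) := by ring
      _ ≤ _ := Nat.mul_le_mul h3 ih

theorem no_small_degree {m q : ℕ} (hm : 5 ≤ m) (hq : 4 ≤ q)
    (hdvd : q * (q - 1) ^ 2 ∣ 2 * (m - 2).factorial) (h3 : 6 ≤ m → 3 ∣ q)
    (hd : 6 ≤ m → ∃ d, m ≤ 2 * d + 1 ∧ d.factorial ≤ 2 * q) : False := by
  have hle := Nat.le_of_dvd (by positivity) hdvd
  obtain ⟨r, rfl⟩ : ∃ r, q = r + 1 := ⟨q - 1, by omega⟩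
  rw [Nat.add_sub_cancel] at hle hdvd
  by_cases h5 : m = 5
  · subst h5
    have : (5 - 2).factorial = 6 := rfl
    rw [this] at hle
    nlinarith
  replace h3 := h3 (by omega)
  obtain ⟨d, hmd, hdq⟩ := hd (by omega)
  by_cases h13 : 14 ≤ m
  · set e := m / 2 with he
    have hed : e ≤ d := by omega
    have h1 := (Nat.factorial_le hed).trans hdq
    have h2 := seventeen_mul_factorial_le (show 7 ≤ e by omega)
    have h4 : (m - 2).factorial ≤ (2 * e - 1).factorial := Nat.factorial_le (by omega)
    have h5 : 5040 ≤ e.factorial := Nat.factorial_le (show 7 ≤ e by omega)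
    have h6 : e.factorial ^ 3 ≤ (2 * (r + 1)) ^ 3 := Nat.pow_le_pow_left h1 3
    have h7 : 49 * (r + 1) ≤ 50 * r := by omega
    have h8 : (49 * (r + 1)) ^ 2 ≤ (50 * r) ^ 2 := Nat.pow_le_pow_left h7 2
    have h9 : (r + 1) * (49 * (r + 1)) ^ 2 ≤ (r + 1) * (50 * r) ^ 2 := Nat.mul_le_mul_left _ h8
    have h10 : 0 < (2 * e - 1).factorial := Nat.factorial_pos _
    have h11 : (r + 1) * (50 * r) ^ 2 = 2500 * ((r + 1) * r ^ 2) := by ring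
    have h12 : (2 * (r + 1)) ^ 3 = 8 * (r + 1) ^ 3 := by ring
    have h13 : (r + 1) * (49 * (r + 1)) ^ 2 = 2401 * (r + 1) ^ 3 := by ring
    omega
  have hde := (Nat.factorial_le (show m / 2 ≤ d by omega)).trans hdq
  have small : ∀ N, (m - 2).factorial ≤ N → ∀ B, 2 * N < (B + 1) * B ^ 2 → r < B := by
    intro N hN B hB
    by_contra! h
    have h1 : (B + 1) * B ^ 2 ≤ (r + 1) * r ^ 2 :=
      Nat.mul_le_mul (by omega) (Nat.pow_le_pow_left h 2)
    omega
  have hm13 : m ≤ 13 := by omega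
  have hm6 : 6 ≤ m := by omega
  clear hd hmd hdq
  interval_cases m <;>
    simp only [Nat.reduceSub, Nat.reduceDiv, Nat.factorial, Nat.reduceMul, Nat.reduceAdd,
      Nat.succ_eq_add_one, zero_add] at hle hdvd hde small
  · have := small _ le_rfl 4 (by norm_num)
    interval_cases r <;> omega
  · have := small _ le_rfl 6 (by norm_num)
    interval_cases r <;> omega
  · have := small _ le_rfl 11 (by norm_num)
    omega
  · have := small _ le_rfl 22 (by norm_num)
    interval_cases r <;> omega
  · have := small _ le_rfl 44 (by norm_num)
    omega
  · have := small _ le_rfl 90 (by norm_num)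
    interval_cases r <;> omega
  · have := small _ le_rfl 194 (by norm_num)
    omega
  · have := small _ le_rfl 431 (by norm_num)
    interval_cases r <;> omega

theorem card_sphere_two {m q : ℕ} (α : Fin m → Fin q) :
    (Finset.univ.filter fun v : Fin m → Fin q => hammingDist v α = 2).card =
      m.choose 2 * (q - 1) ^ 2 := by
  rw [Finset.card_eq_sum_card_fiberwise (t := Finset.powersetCard 2 Finset.univ)
    (f := fun v => Finset.univ.filter fun i => v i ≠ α i)
    (fun v hv => by simpa [Finset.mem_powersetCard, hammingDist] using hv)]
  rw [Finset.sum_const_nat (m := (q - 1) ^ 2), Finset.card_powersetCard, Finset.card_univ,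
    Fintype.card_fin]
  intro s hs
  have hs' := (Finset.mem_powersetCard.mp hs).2
  have : (Finset.univ.filter fun v : Fin m → Fin q => hammingDist v α = 2).filter
      (fun v => (Finset.univ.filter fun i => v i ≠ α i) = s) =
      Fintype.piFinset fun i => if i ∈ s then {α i}ᶜ else {α i} := by
    ext v
    simp only [Finset.mem_filter, Finset.mem_univ, true_and, Fintype.mem_piFinset]
    constructor
    · rintro ⟨-, rfl⟩ i
      by_cases h : v i = α i <;> simp [h]
    · intro h
      have hv : (Finset.univ.filter fun i => v i ≠ α i) = s := by
        ext i
        have := h i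
        split_ifs at this with hi <;> simp_all
      refine ⟨?_, hv⟩
      rw [← hs', ← hv, hammingDist]
  rw [this, Fintype.card_piFinset, ← hs', ← Finset.prod_const,
    ← Finset.prod_subset (Finset.subset_univ s)]
  · refine Finset.prod_congr rfl fun i hi => ?_
    simp [hi, Finset.card_compl]
  · intro i _ hi
    simp [hi]

/-- An action of `G` on the symbols `(i, a)` of `H(m,q)` compatible with actions on the entries
and on the vertices. -/
structure SymbolAction (m q : ℕ) (G : Type*) [Group G] where
  μ : G →* Perm (Fin m)
  ρ : G →* Perm (Fin m × Fin q)
  ν : G →* Perm (V m q)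
  vert : ∀ x v i, ρ x (i, v i) = (μ x i, ν x v (μ x i))

namespace SymbolAction

variable {m q : ℕ} {G : Type*} [Group G] (A : SymbolAction m q G) {α : V m q}

/-- The stabiliser of a symbol. -/
def stab (p : Fin m × Fin q) : Subgroup G :=
  (MulAction.stabilizer (Perm (Fin m × Fin q)) p).comap A.ρ

/-- The stabiliser of a vertex. -/
def vstab (α : V m q) : Subgroup G := (MulAction.stabilizer (Perm (V m q)) α).comap A.ν

theorem mem_stab {x : G} {p : Fin m × Fin q} : x ∈ A.stab p ↔ A.ρ x p = p := Iff.rfl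

theorem mem_vstab {x : G} : x ∈ A.vstab α ↔ A.ν x α = α := Iff.rfl

theorem fst (x : G) (i : Fin m) (a : Fin q) : (A.ρ x (i, a)).1 = A.μ x i := by
  rw [A.vert x (fun _ => a) i]

theorem eq_mk {x : G} {i j : Fin m} (h : A.μ x i = j) (a : Fin q) :
    A.ρ x (i, a) = (j, (A.ρ x (i, a)).2) := by
  rw [← h, ← A.fst x i a]

theorem vstab_apply {x : G} (hx : x ∈ A.vstab α) (i : Fin m) :
    A.ρ x (i, α i) = (A.μ x i, α (A.μ x i)) := by
  rw [A.vert, A.mem_vstab.mp hx]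

/-- The group is large and acts on the radius two ball around the vertex `α` in the way it does
for a codeword `α` of an entry-faithful 2-neighbour transitive code with `δ ≥ 5`. -/
structure IsTwoTransitive (α : V m q) : Prop where
  inj : Function.Injective A.μ
  alt : ∀ σ, Perm.sign σ = 1 → ∃ x, A.μ x = σ
  sep : ∀ x, hammingDist (A.ν x α) α ≤ 4 → x ∈ A.vstab α
  sphere : ∀ k, 1 ≤ k → k ≤ 2 → ∀ u v, hammingDist u α = k → hammingDist v α = k →
    ∃ x ∈ A.vstab α, A.ν x u = v
  move : ∃ x, x ∉ A.vstab α

variable {A}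

theorem IsTwoTransitive.one (h : A.IsTwoTransitive α) {i j : Fin m} {b c : Fin q}
    (hb : b ≠ α i) (hc : c ≠ α j) : ∃ x ∈ A.vstab α, A.ρ x (i, b) = (j, c) := by
  have key : ∀ (i : Fin m) (b : Fin q), b ≠ α i → hammingDist (Function.update α i b) α = 1 := by
    intro i b hb
    rw [hammingDist, Finset.card_eq_one]
    refine ⟨i, ?_⟩
    ext k
    by_cases hk : k = i
    · subst hk; simpa using hb
    · simp [hk]
  obtain ⟨x, hx, hxu⟩ := h.sphere 1 le_rfl one_le_two _ _ (key i b hb) (key j c hc)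
  have h1 := A.vert x (Function.update α i b) i
  have h2 := A.vstab_apply hx i
  rw [hxu, Function.update_self] at h1
  have hij : A.μ x i = j := by
    by_contra hne
    rw [Function.update_of_ne hne, ← h2] at h1
    have := (A.ρ x).injective h1
    exact hb (Prod.ext_iff.mp this).2
  rw [hij, Function.update_self] at h1
  exact ⟨x, hx, h1⟩

theorem IsTwoTransitive.two (h : A.IsTwoTransitive α) {i j i' j' : Fin m} {b c b' c' : Fin q}
    (hij : i ≠ j) (hij' : i' ≠ j') (hb : b ≠ α i) (hc : c ≠ α j) (hb' : b' ≠ α i')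
    (hc' : c' ≠ α j') : ∃ x ∈ A.vstab α,
      (A.ρ x (i, b) = (i', b') ∧ A.ρ x (j, c) = (j', c')) ∨
      (A.ρ x (i, b) = (j', c') ∧ A.ρ x (j, c) = (i', b')) := by
  have key : ∀ (i j : Fin m) (b c : Fin q), i ≠ j → b ≠ α i → c ≠ α j →
      hammingDist (Function.update (Function.update α i b) j c) α = 2 := by
    intro i j b c hij hb hc
    rw [hammingDist, Finset.card_eq_two]
    refine ⟨i, j, hij, ?_⟩
    ext k
    by_cases hk : k = j
    · subst hk; simpa using hc
    · by_cases hk' : k = i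
      · subst hk'; simpa [hk] using hb
      · simp [hk, hk']
  obtain ⟨x, hx, hxu⟩ := h.sphere 2 one_le_two le_rfl _ _ (key i j b c hij hb hc)
    (key i' j' b' c' hij' hb' hc')
  have h2 := A.vstab_apply hx
  have img : ∀ k d, d ≠ α k → Function.update (Function.update α i b) j c k = d →
      A.ρ x (k, d) = (i', b') ∨ A.ρ x (k, d) = (j', c') := by
    intro k d hd hk
    have h1 := A.vert x (Function.update (Function.update α i b) j c) k
    rw [hxu, hk] at h1
    by_cases hj : A.μ x k = j'
    · rw [hj, Function.update_self] at h1
      exact Or.inr h1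
    by_cases hi : A.μ x k = i'
    · rw [hi, Function.update_of_ne hij', Function.update_self] at h1
      exact Or.inl h1
    rw [Function.update_of_ne hj, Function.update_of_ne hi, ← h2] at h1
    exact absurd (Prod.ext_iff.mp ((A.ρ x).injective h1)).2 hd
  have hne : A.ρ x (i, b) ≠ A.ρ x (j, c) := fun h =>
    hij (Prod.ext_iff.mp ((A.ρ x).injective h)).1
  have h3 := img i b hb (by rw [Function.update_of_ne hij, Function.update_self])
  have h4 := img j c hc (Function.update_self ..)
  refine ⟨x, hx, ?_⟩
  rcases h3 with h3 | h3 <;> rcases h4 with h4 | h4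
  · exact absurd (h3.trans h4.symm) hne
  · exact Or.inl ⟨h3, h4⟩
  · exact Or.inr ⟨h3, h4⟩
  · exact absurd (h3.trans h4.symm) hne

theorem exists_ne_symbol (hq : 2 ≤ q) (a : Fin q) : ∃ b : Fin q, b ≠ a := by
  have : Nontrivial (Fin q) := Fin.nontrivial_iff_two_le.mpr hq
  exact exists_ne a

theorem IsTwoTransitive.entry (h : A.IsTwoTransitive α) (hq : 2 ≤ q) (i j : Fin m) :
    ∃ x ∈ A.vstab α, A.μ x i = j := by
  obtain ⟨b, hb⟩ := exists_ne_symbol hq (α i)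
  obtain ⟨c, hc⟩ := exists_ne_symbol hq (α j)
  obtain ⟨x, hx, hxp⟩ := h.one hb hc
  exact ⟨x, hx, by rw [← A.fst x i b, hxp]⟩

theorem IsTwoTransitive.symbol (h : A.IsTwoTransitive α) (hq : 2 ≤ q) (i : Fin m)
    (p : Fin m × Fin q) : ∃ x, A.ρ x (i, α i) = p := by
  obtain ⟨k, c⟩ := p
  by_cases hc : c = α k
  · obtain ⟨x, hx, hxi⟩ := h.entry hq i k
    exact ⟨x, by rw [A.vstab_apply hx, hxi, hc]⟩
  obtain ⟨y, hy⟩ := h.move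
  obtain ⟨j, hj⟩ : ∃ j, A.ν y α j ≠ α j := by
    by_contra! hcon
    exact hy (A.mem_vstab.mpr (funext hcon))
  obtain ⟨z, hz, hzj⟩ := h.entry hq i ((A.μ y)⁻¹ j)
  obtain ⟨w, -, hw⟩ := h.one hj hc
  refine ⟨w * y * z, ?_⟩
  have hzj' : A.μ y ((A.μ y)⁻¹ j) = j := (A.μ y).apply_symm_apply j
  rw [map_mul, map_mul, Perm.mul_apply, Perm.mul_apply, A.vstab_apply hz, hzj, A.vert, hzj', hw]

theorem hammingDist_le_card {x : G} (s : Finset (Fin m))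
    (hs : ∀ i, i ∉ s → A.ρ x (i, α i) = (i, α i)) : hammingDist (A.ν x α) α ≤ s.card := by
  refine Finset.card_le_card fun i hi => ?_
  by_contra his
  have := A.vert x α i
  rw [hs i his] at this
  have h1 := (Prod.ext_iff.mp this).1
  have h2 := (Prod.ext_iff.mp this).2
  simp only at h1 h2
  rw [← h1] at h2
  exact (Finset.mem_filter.mp hi).2 h2.symm

variable (A) in
/-- All 3-cycles on entries fix the vertex `α`. -/
def FixedByC3 (α : V m q) : Prop :=
  ∀ a b c, a ≠ b → a ≠ c → b ≠ c → ∀ x, A.μ x = c3 a b c → x ∈ A.vstab α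

theorem sign_c3 {β : Type*} [DecidableEq β] [Fintype β] {a b c : β} (hab : a ≠ b) (hbc : b ≠ c) :
    Perm.sign (c3 a b c) = 1 := by
  rw [c3, Perm.sign_mul, Perm.sign_swap hab, Perm.sign_swap hbc]; rfl

variable (A) in
/-- The permutation of the alphabet in entry `i` induced by an element fixing that entry. -/
def alphabetPerm (i : Fin m) (x : G) (hx : A.μ x i = i) : Perm (Fin q) where
  toFun a := (A.ρ x (i, a)).2
  invFun a := (A.ρ x⁻¹ (i, a)).2
  left_inv a := by
    beta_reduce
    rw [← A.eq_mk hx, ← Perm.mul_apply, ← map_mul, inv_mul_cancel, map_one, Perm.one_apply]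
  right_inv a := by
    beta_reduce
    rw [← A.eq_mk (show A.μ x⁻¹ i = i by rw [map_inv, Perm.inv_eq_iff_eq, hx]), ← Perm.mul_apply,
      ← map_mul, mul_inv_cancel, map_one, Perm.one_apply]

theorem rho_eq_alphabetPerm {i : Fin m} {x : G} (hx : A.μ x i = i) (a : Fin q) :
    A.ρ x (i, a) = (i, A.alphabetPerm i x hx a) := A.eq_mk hx a

theorem c3_cube {β : Type*} [DecidableEq β] {a b c : β} (hab : a ≠ b) (hac : a ≠ c) (hbc : b ≠ c) :
    c3 a b c ^ 3 = 1 := by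
  ext x
  simp only [pow_succ, pow_zero, one_mul, Perm.mul_apply, c3_apply hab hac hbc, Perm.one_apply]
  split_ifs <;> simp_all

theorem alphabetPerm_cube (hinj : Function.Injective A.μ) {a b c : Fin m} (hab : a ≠ b)
    (hac : a ≠ c) (hbc : b ≠ c) {x : G} (hx : A.μ x = c3 a b c) {i : Fin m} (hi : A.μ x i = i) :
    A.alphabetPerm i x hi ^ 3 = 1 := by
  have h1 : x ^ 3 = 1 := hinj (by rw [map_pow, hx, c3_cube hab hac hbc, map_one])
  refine Perm.ext fun y => ?_
  have h2 : A.ρ (x ^ 3) (i, y) = (i, (A.alphabetPerm i x hi ^ 3) y) := by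
    simp only [pow_succ, pow_zero, one_mul, map_mul, Perm.mul_apply, rho_eq_alphabetPerm hi]
  rw [h1, map_one, Perm.one_apply] at h2
  exact (Prod.ext_iff.mp h2).2.symm

theorem c3_apply_of_notMem {β : Type*} [DecidableEq β] {a b c i : β} (ha : i ≠ a) (hb : i ≠ b)
    (hc : i ≠ c) : c3 a b c i = i := by
  rw [c3, Perm.mul_apply, swap_apply_of_ne_of_ne hb hc, swap_apply_of_ne_of_ne ha hb]

theorem IsTwoTransitive.fixedByC3_of_two (h : A.IsTwoTransitive α) (hq : q = 2) :
    A.FixedByC3 α := by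
  subst hq
  intro a b c hab hac hbc x hx
  refine h.sep x ((hammingDist_le_card {a, b, c} fun i hi => ?_).trans
    (Finset.card_le_three.trans (by norm_num)))
  simp only [Finset.mem_insert, Finset.mem_singleton, not_or] at hi
  have hxi : A.μ x i = i := by rw [hx, c3_apply_of_notMem hi.1 hi.2.1 hi.2.2]
  have hf : ∀ g : Perm (Fin 2), g ^ 3 = 1 → g = 1 := by decide
  rw [rho_eq_alphabetPerm hxi, hf _ (alphabetPerm_cube h.inj hab hac hbc hx hxi), Perm.one_apply]

theorem IsTwoTransitive.fixedByC3_of_three (h : A.IsTwoTransitive α) (hm : 5 ≤ m) (hq : q = 3) :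
    A.FixedByC3 α := by
  subst hq
  have hf : ∀ g k : Perm (Fin 3), g ^ 3 = 1 → k ^ 3 = 1 → g * k = k * g := by decide
  have key : ∀ a b c d, a ≠ b → a ≠ c → a ≠ d → b ≠ c → b ≠ d → c ≠ d → ∀ z,
      A.μ z = swap a b * swap c d → z ∈ A.vstab α := by
    intro a b c d hab hac had hbc hbd hcd z hz
    obtain ⟨x, hx⟩ := h.alt _ (sign_c3 hab hbc)
    obtain ⟨y, hy⟩ := h.alt _ (sign_c3 hab hbd)
    have hzxy : z * (y * x) = x * y := by
      apply h.inj
      simp only [map_mul, hz, hx, hy]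
      rw [← c3_commutator hab hac had hbc hbd hcd]
      group
    refine h.sep z ((hammingDist_le_card {a, b, c, d} fun i hi => ?_).trans Finset.card_le_four)
    simp only [Finset.mem_insert, Finset.mem_singleton, not_or] at hi
    have hxi : A.μ x i = i := by rw [hx, c3_apply_of_notMem hi.1 hi.2.1 hi.2.2.1]
    have hyi : A.μ y i = i := by rw [hy, c3_apply_of_notMem hi.1 hi.2.1 hi.2.2.2]
    set g := A.alphabetPerm i x hxi with hg
    set k := A.alphabetPerm i y hyi with hk
    have hc := hf g k (alphabetPerm_cube h.inj hab hac hbc hx hxi)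
      (alphabetPerm_cube h.inj hab had hbd hy hyi)
    have e1 : ∀ e, A.ρ (x * y) (i, e) = (i, (g * k) e) := fun e => by
      rw [map_mul, Perm.mul_apply, rho_eq_alphabetPerm hyi, rho_eq_alphabetPerm hxi, Perm.mul_apply]
    have e2 : ∀ e, A.ρ (y * x) (i, e) = (i, (k * g) e) := fun e => by
      rw [map_mul, Perm.mul_apply, rho_eq_alphabetPerm hxi, rho_eq_alphabetPerm hyi, Perm.mul_apply]
    have e3 := e1 ((k * g)⁻¹ (α i))
    rw [← hzxy, map_mul, Perm.mul_apply, e2, hc] at e3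
    have e4 : (k * g) ((k * g)⁻¹ (α i)) = α i := (k * g).apply_symm_apply _
    rwa [e4] at e3
  intro c d e hcd hce hde x hx
  have hcard : 1 < ((({c, d, e} : Finset (Fin m)))ᶜ).card := by
    rw [Finset.card_compl, Fintype.card_fin]
    have : ({c, d, e} : Finset (Fin m)).card ≤ 3 := Finset.card_le_three
    omega
  obtain ⟨a, ha, b, hb, hab⟩ := Finset.one_lt_card.mp hcard
  simp only [Finset.mem_compl, Finset.mem_insert, Finset.mem_singleton, not_or] at ha hb
  have hsgn : ∀ u v : Fin m, u ≠ v → Perm.sign (swap a b * swap u v) = 1 := fun u v huv => by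
    rw [Perm.sign_mul, Perm.sign_swap hab, Perm.sign_swap huv]; rfl
  obtain ⟨y, hy⟩ := h.alt _ (hsgn c d hcd)
  obtain ⟨z, hz⟩ := h.alt _ (hsgn d e hde)
  have hxyz : x = y * z := h.inj (by
    rw [map_mul, hx, hy, hz, swap_mul_swap_mul e ha.1 ha.2.1 hb.1 hb.2.1])
  rw [hxyz]
  exact mul_mem (key a b c d hab ha.1 ha.2.1 hb.1 hb.2.1 hcd y hy)
    (key a b d e hab ha.2.1 ha.2.2 hb.2.1 hb.2.2 hde z hz)

variable (A) in
theorem hammingDist_nu (x : G) (u v : V m q) :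
    hammingDist (A.ν x u) (A.ν x v) = hammingDist u v := by
  refine (Finset.card_equiv (A.μ x) fun i => ?_).symm
  simp only [Finset.mem_filter, Finset.mem_univ, true_and, ne_eq, not_iff_not]
  constructor
  · intro huv
    have := A.vert x u i
    rw [huv, A.vert] at this
    exact (Prod.ext_iff.mp this).2.symm
  · intro huv
    have := A.vert x u i
    rw [huv, ← A.vert x v] at this
    exact (Prod.ext_iff.mp ((A.ρ x).injective this)).2

theorem le_five_of_forall_mem_or_mem {m : ℕ} (f : Fin m → Finset (Fin m))
    (hf : ∀ j, (f j).card ≤ 2) (h : ∀ j k, j ≠ k → k ∈ f j ∨ j ∈ f k) : m ≤ 5 := by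
  have hsub : (Finset.univ : Finset (Fin m)).offDiag ⊆
      (Finset.univ.biUnion fun j => (f j).image fun k => (j, k)) ∪
      (Finset.univ.biUnion fun k => (f k).image fun j => (j, k)) := by
    rintro ⟨j, k⟩ hjk
    have := h j k (Finset.mem_offDiag.mp hjk).2.2
    simpa using this
  have h1 := (Finset.card_le_card hsub).trans (Finset.card_union_le _ _)
  have h2 := Finset.card_biUnion_le_card_mul (Finset.univ : Finset (Fin m))
    (fun j => (f j).image fun k => (j, k)) 2 fun j _ => Finset.card_image_le.trans (hf j)
  have h3 := Finset.card_biUnion_le_card_mul (Finset.univ : Finset (Fin m))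
    (fun k => (f k).image fun j => (j, k)) 2 fun j _ => Finset.card_image_le.trans (hf j)
  rw [Finset.offDiag_card] at h1
  simp only [Finset.card_univ, Fintype.card_fin] at h1 h2 h3
  by_contra! hm
  have : 6 * m ≤ m * m := Nat.mul_le_mul_right _ hm
  omega

theorem IsTwoTransitive.fixedByC3_of_fixes_symbol (h : A.IsTwoTransitive α) (hq : 2 ≤ q)
    (hm : 6 ≤ m) {i a b c : Fin m} (hab : a ≠ b) (hac : a ≠ c) (hbc : b ≠ c) {x : G}
    (hx : A.μ x = c3 a b c) (hxi : A.ρ x (i, α i) = (i, α i)) : A.FixedByC3 α := by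
  by_cases hall : ∀ a b c, a ≠ b → a ≠ c → b ≠ c → a ≠ i → b ≠ i → c ≠ i →
      c3 a b c ∈ (A.stab (i, α i)).map A.μ
  · intro a b c hab hac hbc y hy
    refine h.sep y ((hammingDist_le_card {a, b, c} fun j hj => ?_).trans
      (Finset.card_le_three.trans (by norm_num)))
    simp only [Finset.mem_insert, Finset.mem_singleton, not_or] at hj
    obtain ⟨s, hs, hsi⟩ := h.entry hq i j
    have hi : ∀ e, j ≠ e → (A.μ s)⁻¹ e ≠ i := fun e he hei => by
      rw [Perm.inv_eq_iff_eq, hsi] at hei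
      exact he hei.symm
    have hin := (A.μ s)⁻¹.injective
    obtain ⟨z, hz, hzc⟩ := hall _ _ _ (hin.ne hab) (hin.ne hac) (hin.ne hbc) (hi a hj.1)
      (hi b hj.2.1) (hi c hj.2.2)
    have hzs : s * z = y * s := h.inj (by
      rw [map_mul, map_mul, hzc, hy, ← c3_conj]; group)
    have h1 : A.ρ s (i, α i) = (j, α j) := by rw [A.vstab_apply hs, hsi]
    rw [← h1, ← Perm.mul_apply, ← map_mul, ← hzs, map_mul, Perm.mul_apply, A.mem_stab.mp hz]
  push Not at hall
  exfalso
  obtain ⟨a, b, c, hab, hac, hbc, hai, hbi, hci, hW, hfix⟩ :=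
    exists_c3_almost_fixed (W := (A.stab (i, α i)).map A.μ) (i₀ := i)
    ⟨a, b, c, hab, hac, hbc, x, hxi, hx⟩
    (by obtain ⟨a, b, c, h1, h2, h3, h4, h5, h6, h7⟩ := hall
        exact ⟨a, b, c, h1, h2, h3, h4, h5, h6, h7⟩)
    (by rintro _ ⟨y, hy, rfl⟩
        rw [← A.fst y i (α i), A.mem_stab.mp hy])
  obtain ⟨t, ht⟩ := h.alt _ (sign_c3 hab hbc)
  have hti : A.μ t i = i := by rw [ht, c3_apply_of_notMem hai.symm hbi.symm hci.symm]
  obtain ⟨a', ha'⟩ : ∃ a', A.ρ t (i, α i) = (i, a') := ⟨_, A.eq_mk hti _⟩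
  have hne : a' ≠ α i := by
    rintro rfl
    exact hW ⟨t, ha', ht⟩
  have key : ∀ s ∈ A.vstab α, A.ρ s (i, a') = (i, a') → A.μ s a = a ∨ A.μ s a = c := by
    intro s hs hsp
    have hsi : A.μ s i = i := by rw [← A.fst s i a', hsp]
    refine hfix _ ⟨s, ?_, rfl⟩ ⟨t⁻¹ * s * t, ?_, ?_⟩
    · show A.ρ s (i, α i) = (i, α i)
      rw [A.vstab_apply hs, hsi]
    · show A.ρ (t⁻¹ * s * t) (i, α i) = (i, α i)
      rw [map_mul, map_mul, Perm.mul_apply, Perm.mul_apply, ha', hsp, map_inv,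
        Perm.inv_eq_iff_eq, ha']
    · rw [map_mul, map_mul, map_inv, ht]
  choose β hβ using fun j => exists_ne_symbol hq (α j)
  choose s hs hsp using fun j => h.one hne (hβ j)
  have key' : ∀ u ∈ A.vstab α, ∀ j, A.ρ u (i, a') = (j, β j) →
      A.μ u a ∈ ({A.μ (s j) a, A.μ (s j) c} : Finset (Fin m)) := by
    intro u hu j huj
    have h1 := key ((s j)⁻¹ * u) (mul_mem (inv_mem (hs j)) hu) (by
      rw [map_mul, Perm.mul_apply, huj, map_inv, Perm.inv_eq_iff_eq, hsp])
    rw [map_mul, Perm.mul_apply, map_inv, Perm.inv_eq_iff_eq, Perm.inv_eq_iff_eq] at h1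
    simpa using h1
  refine absurd (le_five_of_forall_mem_or_mem
    (fun j => {A.μ (s j) a, A.μ (s j) c}) (fun _ => Finset.card_le_two) ?_) (by omega)
  intro j k hjk
  obtain ⟨u, hu, ⟨h1, h2⟩ | ⟨h1, h2⟩⟩ := h.two hai.symm hjk hne (hβ a) (hβ j) (hβ k)
  · left
    have := key' u hu j h1
    rwa [← A.fst u a (β a), h2] at this
  · right
    have := key' u hu k h1
    rwa [← A.fst u a (β a), h2] at this

theorem IsTwoTransitive.three_dvd (h : A.IsTwoTransitive α) (hq : 2 ≤ q)
    (hm : 6 ≤ m) (hA : ¬ A.FixedByC3 α) : 3 ∣ q := by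
  by_contra h3
  apply hA
  obtain ⟨i, a, b, c, hia, hib, hic, hab, hac, hbc⟩ :
      ∃ i a b c : Fin m, i ≠ a ∧ i ≠ b ∧ i ≠ c ∧ a ≠ b ∧ a ≠ c ∧ b ≠ c :=
    ⟨⟨0, by omega⟩, ⟨1, by omega⟩, ⟨2, by omega⟩, ⟨3, by omega⟩, by simp⟩
  obtain ⟨x, hx⟩ := h.alt _ (sign_c3 hab hbc)
  have hxi : A.μ x i = i := by rw [hx, c3_apply_of_notMem hia hib hic]
  have : Fact (Nat.Prime 3) := ⟨Nat.prime_three⟩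
  obtain ⟨e, he⟩ := Perm.exists_fixed_point_of_prime (p := 3) (n := 1)
    (by rwa [Fintype.card_fin]) (σ := A.alphabetPerm i x hxi)
    (by rw [pow_one]; exact alphabetPerm_cube h.inj hab hac hbc hx hxi)
  obtain ⟨z, hz⟩ := h.symbol hq i (i, e)
  have hin := (A.μ z)⁻¹.injective
  refine h.fixedByC3_of_fixes_symbol hq hm (i := i) (hin.ne hab) (hin.ne hac) (hin.ne hbc)
    (x := z⁻¹ * x * z) ?_ ?_
  · rw [← c3_conj, map_mul, map_mul, map_inv, hx, inv_inv]
  · rw [map_mul, map_mul, Perm.mul_apply, Perm.mul_apply, hz, rho_eq_alphabetPerm hxi, he,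
      map_inv, Perm.inv_eq_iff_eq, hz]

theorem IsTwoTransitive.exists_factorial_le (h : A.IsTwoTransitive α) (hq : 2 ≤ q)
    (hm : 6 ≤ m) (hA : ¬ A.FixedByC3 α) : ∃ d, m ≤ 2 * d + 1 ∧ d.factorial ≤ 2 * q := by
  set i : Fin m := ⟨0, by omega⟩
  rcases exists_c3_or_large_independent ((A.stab (i, α i)).map A.μ) (i₀ := i) with
    ⟨a, b, c, hab, hac, hbc, x, hx, hxc⟩ | ⟨Δ, hi, hcard, hΔ⟩
  · exact absurd (h.fixedByC3_of_fixes_symbol hq hm hab hac hbc hxc hx) hA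
  rw [Fintype.card_fin] at hcard
  refine ⟨Δ.card, hcard, ?_⟩
  have hsign : ∀ σ : alternatingGroup Δ, Perm.sign (Perm.ofSubtype (σ : Perm Δ)) = 1 := fun σ => by
    rw [Perm.sign_ofSubtype]; exact σ.2
  choose x hx using fun σ : alternatingGroup Δ => h.alt _ (hsign σ)
  have hxi : ∀ σ, A.μ (x σ) i = i := fun σ => by
    rw [hx, Perm.ofSubtype_apply_of_not_mem _ hi]
  have hinj : Function.Injective fun σ => (A.ρ (x σ) (i, α i)).2 := by
    intro σ τ hστ
    have h1 : A.ρ (x σ) (i, α i) = A.ρ (x τ) (i, α i) := by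
      rw [A.eq_mk (hxi σ), A.eq_mk (hxi τ)]
      exact congrArg (Prod.mk i) hστ
    have h2 := hΔ (A.μ ((x τ)⁻¹ * x σ)) ⟨_, ?_, rfl⟩ ?_ ?_
    · rw [map_mul, map_inv, hx, hx, inv_mul_eq_one] at h2
      exact Subtype.ext (Perm.ofSubtype_injective h2).symm
    · show A.ρ _ _ = _
      rw [map_mul, Perm.mul_apply, map_inv, Perm.inv_eq_iff_eq, h1]
    · rw [map_mul, map_inv, Perm.sign_mul, Perm.sign_inv, hx, hx, hsign, hsign, mul_one]
    · intro w hw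
      rw [map_mul, map_inv, hx, hx, Perm.mul_apply, Perm.ofSubtype_apply_of_not_mem _ hw,
        Perm.inv_eq_iff_eq, Perm.ofSubtype_apply_of_not_mem _ hw]
  have hle := Fintype.card_le_of_injective _ hinj
  have : Nontrivial Δ := Fintype.one_lt_card_iff_nontrivial.mp (by rw [Fintype.card_coe]; omega)
  have h2 := two_mul_card_alternatingGroup (α := Δ)
  rw [Fintype.card_perm, Fintype.card_coe] at h2
  rw [Fintype.card_fin] at hle
  rw [← h2]
  omega

theorem relIndex_comap_stabilizer {β : Type*} (f : G →* Perm β) (K : Subgroup G) (p : β)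
    (O : Set β) (hO : ∀ b, b ∈ O ↔ ∃ x ∈ K, f x p = b) :
    ((MulAction.stabilizer (Perm β) p).comap f).relIndex K = O.ncard := by
  let _ : MulAction K β := MulAction.compHom β (f.comp K.subtype)
  have h1 : ((MulAction.stabilizer (Perm β) p).comap f).subgroupOf K =
      MulAction.stabilizer K p := by ext; rfl
  have h2 : MulAction.orbit K p = O := by
    ext b
    rw [hO]
    exact ⟨fun ⟨x, hx⟩ => ⟨x, x.2, hx⟩, fun ⟨x, hx, hxb⟩ => ⟨⟨x, hx⟩, hxb⟩⟩
  rw [Subgroup.relIndex, h1, MulAction.index_stabilizer, h2]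

theorem IsTwoTransitive.dvd_index (h : A.IsTwoTransitive α) (hq : 2 ≤ q) (i : Fin m) :
    q ∣ (A.vstab α).index := by
  have h1 : (A.stab (i, α i)).index = m * q := by
    rw [← Subgroup.relIndex_top_right, stab, relIndex_comap_stabilizer A.ρ ⊤ (i, α i) Set.univ
      fun b => by simpa using h.symbol hq i b]
    simp [Set.ncard_univ]
  have h2 : (A.stab (i, α i)).relIndex (A.vstab α) = m := by
    rw [stab, relIndex_comap_stabilizer A.ρ _ (i, α i) (Set.range fun j => (j, α j)),
      ← Set.image_univ, Set.ncard_image_of_injective, Set.ncard_univ, Nat.card_fin]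
    · exact fun j k hjk => (Prod.ext_iff.mp hjk).1
    · rintro b
      constructor
      · rintro ⟨j, rfl⟩
        obtain ⟨x, hx, hxi⟩ := h.entry hq i j
        exact ⟨x, hx, by rw [A.vstab_apply hx, hxi]⟩
      · rintro ⟨x, hx, rfl⟩
        exact ⟨_, (A.vstab_apply hx i).symm⟩
  have h3 := Subgroup.relIndex_mul_index (inf_le_right : A.stab (i, α i) ⊓ A.vstab α ≤ _)
  rw [← Subgroup.relIndex_mul_index (inf_le_left : A.stab (i, α i) ⊓ A.vstab α ≤ _),
    Subgroup.inf_relIndex_right, h1, h2] at h3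
  refine ⟨(A.stab (i, α i) ⊓ A.vstab α).relIndex (A.stab (i, α i)), ?_⟩
  refine Nat.eq_of_mul_eq_mul_left (Fin.pos i) (h3.trans ?_)
  ring

theorem IsTwoTransitive.dvd_card (h : A.IsTwoTransitive α) (hm : 2 ≤ m) (hq : 2 ≤ q) :
    m.choose 2 * (q - 1) ^ 2 ∣ Nat.card (A.vstab α) := by
  have hpos : 0 < m.choose 2 * (q - 1) ^ 2 :=
    Nat.mul_pos (Nat.choose_pos hm) (pow_pos (by omega) 2)
  rw [← card_sphere_two α] at hpos
  obtain ⟨u, hu⟩ := Finset.card_pos.mp hpos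
  have hu := (Finset.mem_filter.mp hu).2
  rw [← card_sphere_two α, ← Set.ncard_coe_finset,
    ← relIndex_comap_stabilizer A.ν (A.vstab α) u]
  · exact Subgroup.relIndex_dvd_card _ _
  intro v
  simp only [Finset.coe_filter, Finset.mem_univ, true_and, Set.mem_ofPred_eq]
  constructor
  · exact h.sphere 2 one_le_two le_rfl u v hu
  · rintro ⟨x, hx, rfl⟩
    rw [← hu, ← A.hammingDist_nu x u α, A.mem_vstab.mp hx]

theorem IsTwoTransitive.dvd_factorial (h : A.IsTwoTransitive α) (hm : 2 ≤ m) (hq : 2 ≤ q) :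
    q * (q - 1) ^ 2 ∣ 2 * (m - 2).factorial := by
  have h1 := mul_dvd_mul (h.dvd_card hm hq) (h.dvd_index hq ⟨0, by omega⟩)
  rw [Subgroup.card_mul_index] at h1
  have h2 := h1.trans (Subgroup.card_dvd_of_injective A.μ h.inj)
  rw [Nat.card_perm, Nat.card_fin] at h2
  have h3 : m.factorial = m.choose 2 * (2 * (m - 2).factorial) := by
    rw [← Nat.choose_mul_factorial_mul_factorial hm, Nat.factorial_two, mul_assoc]
  rw [h3, mul_assoc, mul_comm _ q] at h2
  exact Nat.dvd_of_mul_dvd_mul_left (Nat.choose_pos hm) h2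

theorem IsTwoTransitive.fixedByC3 (h : A.IsTwoTransitive α) (hm : 5 ≤ m) (hq : 2 ≤ q) :
    A.FixedByC3 α := by
  rcases Nat.lt_or_ge q 4 with hq4 | hq4
  · obtain rfl | rfl : q = 2 ∨ q = 3 := by omega
    · exact h.fixedByC3_of_two rfl
    · exact h.fixedByC3_of_three hm rfl
  by_contra hA
  exact no_small_degree hm hq4 (h.dvd_factorial (by omega) hq)
    (fun hm6 => h.three_dvd hq hm6 hA) (fun hm6 => h.exists_factorial_le hq hm6 hA)

theorem IsTwoTransitive.mem_vstab_of_sign (h : A.IsTwoTransitive α) (hA : A.FixedByC3 α) {x : G}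
    (hx : Perm.sign (A.μ x) = 1) : x ∈ A.vstab α := by
  have hle : alternatingGroup (Fin m) ≤ (A.vstab α).map A.μ := by
    rw [← Perm.closure_three_cycles_eq_alternating, Subgroup.closure_le]
    intro σ hσ
    obtain ⟨y, hy⟩ := h.alt σ (Perm.IsThreeCycle.sign hσ)
    refine ⟨y, ?_, hy⟩
    obtain ⟨a, ha⟩ : σ.support.Nonempty := by
      rw [← Finset.card_pos, Perm.IsThreeCycle.card_support hσ]; norm_num
    have hnd := (Perm.IsThreeCycle.nodup_iff_mem_support hσ).mpr ha
    have heq := (Perm.IsThreeCycle.eq_swap_mul_swap_iff_mem_support hσ).mpr ha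
    simp only [List.nodup_cons, List.mem_cons, List.not_mem_nil, or_false, not_or] at hnd
    exact hA _ _ _ hnd.1.1 hnd.1.2 hnd.2.1 y (hy.trans heq)
  obtain ⟨y, hy, hyx⟩ := hle (Perm.mem_alternatingGroup.mpr hx)
  rwa [← h.inj hyx]

theorem IsTwoTransitive.sign_eq_one_iff (h : A.IsTwoTransitive α) (hA : A.FixedByC3 α) {x : G} :
    Perm.sign (A.μ x) = 1 ↔ x ∈ A.vstab α := by
  refine ⟨h.mem_vstab_of_sign hA, fun hx => ?_⟩
  by_contra hs
  obtain ⟨y, hy⟩ := h.move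
  have h1 : Perm.sign (A.μ y) ≠ 1 := fun h1 => hy (h.mem_vstab_of_sign hA h1)
  refine hy ?_
  rw [← mul_inv_cancel_left x y]
  refine mul_mem hx (h.mem_vstab_of_sign hA ?_)
  rw [map_mul, Perm.sign_mul, map_inv, Perm.sign_inv, (Int.units_eq_one_or _).resolve_left hs,
    (Int.units_eq_one_or _).resolve_left h1]
  rfl

theorem IsTwoTransitive.nu_eq_or_eq (h : A.IsTwoTransitive α) (hA : A.FixedByC3 α) {x : G}
    (hx : x ∉ A.vstab α) (y : G) : A.ν y α = α ∨ A.ν y α = A.ν x α := by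
  by_cases hy : y ∈ A.vstab α
  · exact Or.inl hy
  right
  have h1 : x⁻¹ * y ∈ A.vstab α := by
    rw [← h.sign_eq_one_iff hA] at hx hy ⊢
    rw [map_mul, Perm.sign_mul, map_inv, Perm.sign_inv, (Int.units_eq_one_or _).resolve_left hx,
      (Int.units_eq_one_or _).resolve_left hy]
    rfl
  have h2 := A.mem_vstab.mp h1
  rwa [map_mul, Perm.mul_apply, map_inv, Perm.inv_eq_iff_eq] at h2

theorem IsTwoTransitive.eq_of_ne (h : A.IsTwoTransitive α) (hA : A.FixedByC3 α) {x : G}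
    (hx : x ∉ A.vstab α) (j : Fin m) {c : Fin q} (hc : c ≠ α j) : c = A.ν x α j := by
  obtain ⟨i, hi⟩ : ∃ i, A.ν x α i ≠ α i := by
    by_contra! hcon
    exact hx (A.mem_vstab.mpr (funext hcon))
  obtain ⟨s, hs, hsp⟩ := h.one hi hc
  have h1 : x⁻¹ * s * x ∈ A.vstab α := by
    rw [← h.sign_eq_one_iff hA] at hs ⊢
    rw [map_mul, Perm.sign_mul, map_mul, Perm.sign_mul, hs, mul_one, map_inv, Perm.sign_inv,
      Int.units_mul_self]
  have h2 := A.mem_vstab.mp h1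
  rw [map_mul, map_mul, Perm.mul_apply, Perm.mul_apply, map_inv, Perm.inv_eq_iff_eq] at h2
  rw [A.vert, h2] at hsp
  have h3 := Prod.ext_iff.mp hsp
  simp only at h3
  rw [← h3.2, h3.1]

end SymbolAction

section HammingAut

variable {m q : ℕ}

theorem hAut_mul (g h : Fin m → Perm (Fin q)) (σ τ : Perm (Fin m)) :
    hAut m q g σ * hAut m q h τ = hAut m q (fun i => g i * h (σ⁻¹ i)) (σ * τ) := by
  ext v i
  simp [hAut]

theorem hAut_one : hAut m q (fun _ => 1) 1 = 1 := by
  ext v i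
  simp [hAut]

theorem hAut_inj (hq : 2 ≤ q) {g h : Fin m → Perm (Fin q)} {σ τ : Perm (Fin m)}
    (he : hAut m q g σ = hAut m q h τ) : g = h ∧ σ = τ := by
  have h1 : ∀ (v : V m q) i, g i (v (σ⁻¹ i)) = h i (v (τ⁻¹ i)) := fun v i =>
    congrFun (congrArg (fun f : Perm (V m q) => f v) he) i
  have hg : g = h := funext fun i => Perm.ext fun a => h1 (fun _ => a) i
  subst hg
  refine ⟨rfl, inv_injective (Perm.ext fun i => ?_)⟩
  by_contra hne
  have := (g i).injective (h1 (Function.update (fun _ => ⟨0, by omega⟩) (σ⁻¹ i) ⟨1, by omega⟩) i)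
  rw [Function.update_self, Function.update_of_ne (Ne.symm hne)] at this
  simp at this

theorem exists_symbolAction (hq : 2 ≤ q) {X : Subgroup (Perm (V m q))}
    (hX : X ≤ HammingAut m q) : ∃ A : SymbolAction m q X, A.ν = X.subtype ∧
      ∀ x σ, A.μ x = σ ↔ ∃ g, (x : Perm (V m q)) = hAut m q g σ := by
  choose g σ hgσ using fun x : X => hX x.2
  have hone : (g 1 = fun _ => 1) ∧ σ 1 = 1 := hAut_inj hq (by rw [← hgσ, hAut_one]; rfl)
  have hmul : ∀ x y, (g (x * y) = fun i => g x i * g y ((σ x)⁻¹ i)) ∧ σ (x * y) = σ x * σ y :=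
    fun x y => hAut_inj hq (by rw [← hgσ, ← hAut_mul, ← hgσ, ← hgσ]; rfl)
  let ρ : X →* Function.End (Fin m × Fin q) :=
    { toFun x p := (σ x p.1, g x (σ x p.1) p.2)
      map_one' := by
        funext p
        simp only [hone.1, hone.2, Perm.one_apply]
        rfl
      map_mul' x y := by
        funext p
        simp [(hmul x y).1, (hmul x y).2]
        rfl }
  refine ⟨⟨⟨⟨σ, hone.2⟩, fun x y => (hmul x y).2⟩, ρ.toHomPerm, X.subtype, ?_⟩, rfl, ?_⟩
  · intro x v i
    show (σ x i, g x (σ x i) (v i)) = (σ x i, (x : Perm (V m q)) v (σ x i))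
    rw [hgσ x]
    simp [hAut]
  · intro x τ
    show σ x = τ ↔ _
    constructor
    · rintro rfl
      exact ⟨g x, hgσ x⟩
    · rintro ⟨k, hk⟩
      exact (hAut_inj hq ((hgσ x).symm.trans hk)).2

theorem five_le_hammingDist {C : Set (V m q)} (hδ : 5 ≤ minDist m q C) {α β : V m q}
    (hα : α ∈ C) (hβ : β ∈ C) (hne : α ≠ β) : 5 ≤ hammingDist α β :=
  hδ.trans (Nat.sInf_le ⟨α, hα, β, hβ, hne, rfl⟩)

theorem mem_cell_of_hammingDist {C : Set (V m q)} (hδ : 5 ≤ minDist m q C) {α u : V m q}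
    (hα : α ∈ C) {k : ℕ} (hk : k ≤ 2) (hu : hammingDist u α = k) : u ∈ cell m q C k := by
  refine le_antisymm (Nat.sInf_le ⟨α, hα, hu⟩) (le_csInf ⟨k, α, hα, hu⟩ ?_)
  rintro d ⟨β, hβ, rfl⟩
  by_cases hne : α = β
  · rw [← hne, hu]
  have h1 := five_le_hammingDist hδ hα hβ hne
  have h2 := hammingDist_triangle_left α β u
  omega

theorem isTwoTransitive_of_isNT {X : Subgroup (Perm (V m q))} {C : Set (V m q)}
    (hC : 2 ≤ C.ncard) (hδ : 5 ≤ minDist m q C)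
    (hNT : IsNT m q X C 2) (hEF : EntryFaithful m q X)
    (hle : (alternatingGroup (Fin m) : Set (Perm (Fin m))) ⊆ entryImage m q X)
    (A : SymbolAction m q X) (hν : A.ν = X.subtype)
    (hμ : ∀ x σ, A.μ x = σ ↔ ∃ g, (x : Perm (V m q)) = hAut m q g σ) {α : V m q} (hα : α ∈ C) :
    A.IsTwoTransitive α := by
  have hνx : ∀ x v, A.ν x v = (x : Perm (V m q)) v := fun x v => by rw [hν]; rfl
  have hsep : ∀ x, hammingDist (A.ν x α) α ≤ 4 → x ∈ A.vstab α := by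
    intro x hx
    by_contra hne
    have h1 := five_le_hammingDist hδ (hNT.2.1.2.1 _ x.2 α hα) hα
      (by rw [← hνx]; exact hne)
    rw [← hνx] at h1
    omega
  refine ⟨?_, ?_, hsep, ?_, ?_⟩
  · rw [injective_iff_map_eq_one]
    intro x hx
    exact Subtype.ext (hEF x x.2 ((hμ x 1).mp hx))
  · intro σ hσ
    obtain ⟨x, hx, hg⟩ := hle (Perm.mem_alternatingGroup.mpr hσ)
    exact ⟨⟨x, hx⟩, (hμ _ _).mpr hg⟩
  · intro k hk1 hk2 u v hu hv
    obtain ⟨x, hx, hxu⟩ := (hNT.2.2 k hk1 hk2).2.2 u (mem_cell_of_hammingDist hδ hα hk2 hu) v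
      (mem_cell_of_hammingDist hδ hα hk2 hv)
    refine ⟨⟨x, hx⟩, hsep _ ?_, (hνx _ _).trans hxu⟩
    have h1 := A.hammingDist_nu ⟨x, hx⟩ α u
    rw [hνx _ u, hammingDist_comm α u, hu] at h1
    have h2 := hammingDist_triangle (A.ν ⟨x, hx⟩ α) (x u) α
    rw [h1] at h2
    rw [hxu, hv] at h2
    omega
  · obtain ⟨β, hβ, hne⟩ := Set.exists_ne_of_one_lt_ncard hC α
    obtain ⟨x, hx, hxα⟩ := hNT.2.1.2.2 α hα β hβ
    exact ⟨⟨x, hx⟩, fun h => hne (by rw [← hxα, ← hνx ⟨x, hx⟩]; exact h)⟩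

theorem codeEquiv_repCode {α β : V m 2} (h : ∀ i, β i ≠ α i) :
    CodeEquiv m 2 {α, β} (RepCode m 2) := by
  refine ⟨hAut m 2 (fun i => swap (α i) 0) 1, ⟨_, _, rfl⟩, ?_⟩
  have h0 : hAut m 2 (fun i => swap (α i) 0) 1 α = fun _ => 0 := by
    funext i
    simp [hAut]
  have h1 : hAut m 2 (fun i => swap (α i) 0) 1 β = fun _ => 1 := by
    funext i
    have : ∀ a b : Fin 2, b ≠ a → swap a 0 b = 1 := by decide
    simpa [hAut] using this _ _ (h i)
  rw [Set.image_pair, h0, h1]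
  ext v
  simp only [Set.mem_insert_iff, Set.mem_singleton_iff, RepCode, Set.mem_ofPred_eq]
  constructor
  · rintro (rfl | rfl)
    · exact ⟨0, rfl⟩
    · exact ⟨1, rfl⟩
  · rintro ⟨a, rfl⟩
    fin_cases a
    · exact Or.inl rfl
    · exact Or.inr rfl

end HammingAut

end NT


open NT Equiv in
/-- Lemma 3.3: if `C` is entry-faithful `(X,2)`-neighbour transitive
with `δ ≥ 5`, `|C| ≥ 2`, and `μ(X)` is `Alt(M)` or `Sym(M)`, then `q = 2`, `C` is
equivalent to the binary repetition code, and `μ(X) = Sym(M)`. -/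
theorem stmt_13 (m q : ℕ) (hm : 2 ≤ m) (hq : 2 ≤ q)
    (X : Subgroup (Perm (V m q))) (C : Set (V m q))
    (hC : 2 ≤ C.ncard) (hδ : 5 ≤ minDist m q C)
    (hNT : IsNT m q X C 2) (hEF : EntryFaithful m q X)
    (him : entryImage m q X = (alternatingGroup (Fin m) : Set (Perm (Fin m))) ∨
      entryImage m q X = Set.univ) :
    q = 2 ∧ CodeEquiv m q C (RepCode m q) ∧ entryImage m q X = Set.univ := by
  have hle : (alternatingGroup (Fin m) : Set (Perm (Fin m))) ⊆ entryImage m q X := by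
    rcases him with h | h
    · exact h.ge
    · exact h ▸ Set.subset_univ _
  obtain ⟨α, hα⟩ := hNT.2.1.1
  obtain ⟨A, hν, hμ⟩ := exists_symbolAction hq hNT.1
  have hνx : ∀ x v, A.ν x v = (x : Perm (V m q)) v := fun x v => by rw [hν]; rfl
  have h := isTwoTransitive_of_isNT hC hδ hNT hEF hle A hν hμ hα
  obtain ⟨β, hβ, hne⟩ := Set.exists_ne_of_one_lt_ncard hC α
  have hm5 : 5 ≤ m := (five_le_hammingDist hδ hβ hα hne).trans
    (hammingDist_le_card_fintype.trans (Fintype.card_fin m).le)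
  have hA := h.fixedByC3 hm5 hq
  obtain ⟨x, hx⟩ := h.move
  have heq := fun j c hc => h.eq_of_ne hA hx j (c := c) hc
  have hxC : A.ν x α ∈ C := by rw [hνx]; exact hNT.2.1.2.1 _ x.2 α hα
  have hCeq : C = {α, A.ν x α} := by
    refine Set.Subset.antisymm (fun γ hγ => ?_)
      (Set.insert_subset hα (Set.singleton_subset_iff.mpr hxC))
    obtain ⟨y, hy, rfl⟩ := hNT.2.1.2.2 α hα γ hγ
    rw [← hνx ⟨y, hy⟩]
    exact h.nu_eq_or_eq hA hx ⟨y, hy⟩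
  have hne' : ∀ i, A.ν x α i ≠ α i := fun i => by
    obtain ⟨c, hc⟩ := SymbolAction.exists_ne_symbol hq (α i)
    rwa [← heq i c hc]
  have hq2 : q = 2 := by
    refine le_antisymm ?_ hq
    let i : Fin m := ⟨0, by omega⟩
    have hsub : (Finset.univ : Finset (Fin q)) ⊆ {α i, A.ν x α i} := fun c _ => by
      by_cases hc : c = α i
      · simp [hc]
      · simp [← heq i c hc]
    have := (Finset.card_le_card hsub).trans Finset.card_le_two
    rwa [Finset.card_univ, Fintype.card_fin] at this
  refine ⟨hq2, ?_, him.resolve_left fun him => hx (h.mem_vstab_of_sign hA ?_)⟩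
  · subst hq2
    rw [hCeq]
    exact codeEquiv_repCode hne'
  · have hmem : A.μ x ∈ entryImage m q X := ⟨x, x.2, (hμ x _).mp rfl⟩
    rw [him] at hmem
    exact Perm.mem_alternatingGroup.mp hmem
end

section
/- Let E ⊆ H(11,2) be the even weight subcode of the punctured Hadamard code of length 12. Then E is not (X,3)-neighbour transitive for any group X ≤ Aut(E); in particular, E is not X-completely transitive for any X. -/
open Equiv

namespace NT

theorem hAut_hammingDist {m q : ℕ} (g : Fin m → Perm (Fin q)) (σ : Perm (Fin m))
    (α β : V m q) : hammingDist (hAut m q g σ α) (hAut m q g σ β) = hammingDist α β := by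
  unfold hammingDist
  refine Finset.card_bij (fun i _ => σ⁻¹ i) ?_ ?_ ?_
  · intro i hi
    simpa [hAut] using hi
  · intro i _ j _ h
    exact σ⁻¹.injective h
  · intro j hj
    exact ⟨σ j, by simpa [hAut] using hj, by simp⟩

theorem hammingDist_of_mem_HammingAut {m q : ℕ} {x : Perm (V m q)} (hx : x ∈ HammingAut m q)
    (α β : V m q) : hammingDist (x α) (x β) = hammingDist α β := by
  obtain ⟨g, σ, rfl⟩ := hx
  exact hAut_hammingDist g σ α β

theorem distTo_eq_of_forall_le {m q : ℕ} {C : Set (V m q)} {α β : V m q} {r : ℕ}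
    (hβ : β ∈ C) (hr : hammingDist α β = r) (h : ∀ γ ∈ C, r ≤ hammingDist α γ) :
    distTo m q C α = r :=
  IsLeast.csInf_eq ⟨⟨β, hβ, hr⟩, by rintro _ ⟨γ, hγ, rfl⟩; exact h γ hγ⟩

theorem distTo_le_hammingDist {m q : ℕ} {C : Set (V m q)} {α β : V m q} (hβ : β ∈ C) :
    distTo m q C α ≤ hammingDist α β :=
  Nat.sInf_le ⟨β, hβ, rfl⟩

/-- Vertices of a common cell that is an orbit see the same distances to the code. -/
theorem IsNT.exists_hammingDist_eq {m q s i : ℕ} {X : Subgroup (Perm (V m q))}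
    {C : Set (V m q)} (h : IsNT m q X C s) (hi : 1 ≤ i) (his : i ≤ s) {ν μ β : V m q}
    (hν : ν ∈ cell m q C i) (hμ : μ ∈ cell m q C i) (hβ : β ∈ C) :
    ∃ γ ∈ C, hammingDist μ γ = hammingDist ν β := by
  obtain ⟨hX, hC, hcell⟩ := h
  obtain ⟨x, hx, rfl⟩ := (hcell i hi his).2.2 ν hν μ hμ
  exact ⟨x β, hC.2.1 x hx β hβ, hammingDist_of_mem_HammingAut (hX hx) ν β⟩

theorem distTo_le_covRad {m q : ℕ} {C : Set (V m q)} (hC : C.Nonempty) (α : V m q) :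
    distTo m q C α ≤ covRad m q C := by
  obtain ⟨β, hβ⟩ := hC
  refine le_csSup ⟨m, ?_⟩ ⟨α, rfl⟩
  rintro _ ⟨γ, rfl⟩
  simpa using (distTo_le_hammingDist hβ).trans (hammingDist_le_card_fintype (x := γ) (y := β))

theorem forall_mem_ESub {p : V 11 2 → Prop} :
    (∀ γ ∈ ESub, p γ) ↔ p (fun _ => 0) ∧ ∀ b, p (hadRow b) := by
  simp [ESub]

/-- A vertex at distance 3 from `ESub` and at distance 9 from some codeword. -/
def farVertex : V 11 2 := ![0, 0, 0, 0, 0, 0, 0, 0, 1, 1, 1]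

/-- A vertex at distance 3 from `ESub` and at distance 9 from no codeword. -/
def nearVertex : V 11 2 := ![0, 0, 0, 0, 0, 0, 0, 1, 0, 1, 1]

theorem zero_mem_ESub : (fun _ => 0) ∈ ESub := Set.mem_insert _ _

theorem farVertex_mem_cell : farVertex ∈ cell 11 2 ESub 3 :=
  distTo_eq_of_forall_le zero_mem_ESub (by decide) (forall_mem_ESub.2 (by decide +kernel))

theorem nearVertex_mem_cell : nearVertex ∈ cell 11 2 ESub 3 :=
  distTo_eq_of_forall_le zero_mem_ESub (by decide) (forall_mem_ESub.2 (by decide +kernel))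

theorem exists_hammingDist_farVertex : ∃ β ∈ ESub, hammingDist farVertex β = 9 := by
  obtain ⟨b, hb⟩ : ∃ b, hammingDist farVertex (hadRow b) = 9 := by decide +kernel
  exact ⟨hadRow b, Set.mem_insert_of_mem _ ⟨b, rfl⟩, hb⟩

theorem hammingDist_nearVertex_ne : ∀ γ ∈ ESub, hammingDist nearVertex γ ≠ 9 :=
  forall_mem_ESub.2 (by decide +kernel)

theorem not_isNT_ESub {s : ℕ} (hs : 3 ≤ s) (X : Subgroup (Perm (V 11 2))) :
    ¬ IsNT 11 2 X ESub s := by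
  intro h
  obtain ⟨β, hβ, hd⟩ := exists_hammingDist_farVertex
  obtain ⟨γ, hγ, hγd⟩ :=
    h.exists_hammingDist_eq (by norm_num) hs farVertex_mem_cell nearVertex_mem_cell hβ
  exact hammingDist_nearVertex_ne γ hγ (hγd.trans hd)

theorem three_le_covRad_ESub : 3 ≤ covRad 11 2 ESub := by
  have h : distTo 11 2 ESub farVertex = 3 := farVertex_mem_cell
  exact h ▸ distTo_le_covRad ⟨_, zero_mem_ESub⟩ farVertex

end NT

open NT Equiv in
/-- Lemma 4.2, second part: `E` is not `(X,3)`-neighbour transitive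
for any group `X`; in particular `E` is not `X`-completely transitive for any `X`. -/
theorem stmt_15 :
    (∀ X : Subgroup (Perm (V 11 2)), ¬ IsNT 11 2 X ESub 3) ∧
    (∀ X : Subgroup (Perm (V 11 2)), ¬ IsNT 11 2 X ESub (covRad 11 2 ESub)) :=
  ⟨not_isNT_ESub le_rfl, not_isNT_ESub three_le_covRad_ESub⟩
end

section
/- Let C be a 2-regular code in H(11,2) with minimum distance δ ≥ 5 and |C| ≥ 2. Then exactly one of the following holds: (1) δ = 11 and C is equivalent to the binary repetition code Rep(11,2); (2) δ = 5 and C is equivalent to the punctured Hadamard code P of length 12; or (3) δ = 6 and C is equivalent to the even weight subcode E of P. -/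
open Equiv

namespace Biplane

/-- The incidence of point `j` with the `k`-th pair of points of `Fin 5`. -/
def pairInc (k : Fin 10) (j : Fin 5) : Bool :=
  j = ![0, 0, 0, 0, 1, 1, 1, 2, 2, 3] k || j = ![1, 2, 3, 4, 2, 3, 4, 3, 4, 4] k

/-- The twelve pentagons on `Fin 5`, as sets of pairs, in two classes of six: two pentagons
share exactly two edges if and only if they are distinct members of the same class. -/
def pentagon (s : Bool) (p : Fin 6) (k : Fin 10) : Bool :=
  Nat.testBit (bif s then ![220, 570, 358, 425, 789, 707] p else ![316, 234, 598, 665, 453, 803] p) k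

/-- The incidence matrix determined by a class of pentagons: one block `Fin 5`, and for each
pair a block consisting of the pair and of the pentagons having it as an edge. -/
def normalForm (s : Bool) : Option (Fin 10) → Fin 5 ⊕ Fin 6 → Bool
  | none, .inl _ => true
  | none, .inr _ => false
  | some k, .inl j => pairInc k j
  | some k, .inr p => pentagon s p k

theorem eq_pentagon (c : Fin 10 → Bool)
    (hc : ∀ j, ∑ k, (c k && pairInc k j).toNat = 2) : ∃ s p, c = pentagon s p := by
  have key : ∀ b₀ b₁ b₂ b₃ b₄ b₅ b₆ b₇ b₈ b₉ : Bool,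
      (∀ j, ∑ k, (![b₀, b₁, b₂, b₃, b₄, b₅, b₆, b₇, b₈, b₉] k && pairInc k j).toNat = 2) →
      ∃ s p, ∀ k, ![b₀, b₁, b₂, b₃, b₄, b₅, b₆, b₇, b₈, b₉] k = pentagon s p k := by
    decide +kernel
  have e : c = ![c 0, c 1, c 2, c 3, c 4, c 5, c 6, c 7, c 8, c 9] := by
    ext k; fin_cases k <;> rfl
  rw [e] at hc ⊢
  obtain ⟨s, p, h⟩ := key _ _ _ _ _ _ _ _ _ _ hc
  exact ⟨s, p, funext h⟩

theorem pentagon_inter : ∀ s s' p p', ∑ k, (pentagon s p k && pentagon s' p' k).toNat = 2 →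
    s = s' ∧ p ≠ p' := by
  decide +kernel

theorem eq_pairInc_of_sum : ∀ (k : Fin 10) (v : Fin 5 → Bool), (∑ j, (v j).toNat = 2) →
    v (![0, 0, 0, 0, 1, 1, 1, 2, 2, 3] k) = true → v (![1, 2, 3, 4, 2, 3, 4, 3, 4, 4] k) = true →
    ∀ j, v j = pairInc k j := by
  decide +kernel

theorem pairInc_injective : ∀ k k', (∀ j, pairInc k j = pairInc k' j) → k = k' := by
  decide +kernel

/-- An incidence matrix of a `2-(11,5,2)` design, given as a symmetric design by its row and
column sums and the intersection numbers of rows. -/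
structure IsBiplane (N : Fin 11 → Fin 11 → Bool) : Prop where
  row : ∀ r, ∑ k, (N r k).toNat = 5
  col : ∀ k, ∑ r, (N r k).toNat = 5
  inter : ∀ r s, r ≠ s → ∑ k, (N r k && N s k).toNat = 2

variable {N : Fin 11 → Fin 11 → Bool}

theorem IsBiplane.inter_col (h : IsBiplane N) {x y : Fin 11} (hxy : x ≠ y) :
    ∑ r, (N r x && N r y).toNat = 2 := by
  let A : Matrix (Fin 11) (Fin 11) ℚ := fun r k => ((N r k).toNat : ℚ)
  let B : Matrix (Fin 11) (Fin 11) ℚ := fun k r => (A r k - 2 / 5) / 3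
  have hand : ∀ a b : Bool, ((a && b).toNat : ℚ) = (a.toNat : ℚ) * b.toNat := by simp
  have hrow : ∀ r, ∑ k, A r k = 5 := fun r => by
    simp only [A]; exact_mod_cast h.row r
  have hcol : ∀ k, ∑ r, A r k = 5 := fun k => by
    simp only [A]; exact_mod_cast h.col k
  have hAB : A * B = 1 := by
    ext r s
    have h1 : (A * B) r s = (∑ k, A r k * A s k - 2 / 5 * ∑ k, A r k) / 3 := by
      rw [Matrix.mul_apply, Finset.mul_sum, ← Finset.sum_sub_distrib, Finset.sum_div]
      exact Finset.sum_congr rfl fun k _ => by simp only [B]; ring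
    have h2 : ∑ k, A r k * A s k = ((∑ k, (N r k && N s k).toNat : ℕ) : ℚ) := by
      push_cast
      exact Finset.sum_congr rfl fun k _ => (hand _ _).symm
    rw [h1, hrow, h2]
    by_cases hrs : r = s
    · subst hrs
      simp only [Bool.and_self, h.row, Matrix.one_apply_eq]
      norm_num
    · rw [h.inter r s hrs, Matrix.one_apply_ne hrs]
      norm_num
  have hBA : B * A = 1 := mul_eq_one_comm.mp hAB
  have h1 : (B * A) x y = (∑ r, A r x * A r y - 2 / 5 * ∑ r, A r y) / 3 := by
    rw [Matrix.mul_apply, Finset.mul_sum, ← Finset.sum_sub_distrib, Finset.sum_div]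
    exact Finset.sum_congr rfl fun k _ => by simp only [B]; ring
  have h2 : ∑ r, A r x * A r y = ((∑ r, (N r x && N r y).toNat : ℕ) : ℚ) := by
    push_cast
    exact Finset.sum_congr rfl fun k _ => (hand _ _).symm
  rw [hBA, Matrix.one_apply_ne hxy, hcol, h2] at h1
  have h3 : ((∑ r, (N r x && N r y).toNat : ℕ) : ℚ) = 2 := by linarith
  exact_mod_cast h3

theorem card_filter_eq_sum_toNat {α : Type*} [Fintype α] (f : α → Bool) :
    Fintype.card {a // f a = true} = ∑ a, (f a).toNat := by
  classical
  rw [Fintype.card_subtype, Finset.card_filter]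
  exact Finset.sum_congr rfl fun a _ => by cases f a <;> rfl

theorem IsBiplane.exists_pointEquiv (h : IsBiplane N) (r : Fin 11) :
    ∃ e : Fin 5 ⊕ Fin 6 ≃ Fin 11, (∀ j, N r (e (.inl j)) = true) ∧
      ∀ p, N r (e (.inr p)) = false := by
  have h5 : Fintype.card {k // N r k = true} = 5 := by
    rw [card_filter_eq_sum_toNat, h.row]
  have h6 : Fintype.card {k // ¬ N r k = true} = 6 := by
    rw [Fintype.card_subtype_compl, h5, Fintype.card_fin]
  let e5 := (Fintype.equivFinOfCardEq h5).symm
  let e6 := (Fintype.equivFinOfCardEq h6).symm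
  refine ⟨(Equiv.sumCongr e5 e6).trans (Equiv.sumCompl _), fun j => ?_, fun p => ?_⟩
  · simpa using (e5 j).2
  · simpa using (e6 p).2

theorem IsBiplane.exists_row (h : IsBiplane N) (r : Fin 11) (e : Fin 5 ⊕ Fin 6 ≃ Fin 11)
    (he : ∀ j, N r (e (.inl j)) = true) (he' : ∀ p, N r (e (.inr p)) = false) (k : Fin 10) :
    ∃ s, s ≠ r ∧ ∀ j, N s (e (.inl j)) = pairInc k j := by
  have hne : ∀ k : Fin 10, (![0, 0, 0, 0, 1, 1, 1, 2, 2, 3] k : Fin 5) ≠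
      ![1, 2, 3, 4, 2, 3, 4, 3, 4, 4] k := by decide
  have hsum := h.inter_col (x := e (.inl _)) (y := e (.inl _))
    (fun H => hne k (Sum.inl_injective (e.injective H)))
  obtain ⟨s, hs, hN⟩ : ∃ s, s ≠ r ∧ (N s (e (.inl (![0, 0, 0, 0, 1, 1, 1, 2, 2, 3] k))) &&
      N s (e (.inl (![1, 2, 3, 4, 2, 3, 4, 3, 4, 4] k)))) = true := by
    by_contra! H
    rw [Finset.sum_eq_single r (fun s _ hs => by simp [H s hs]) (by simp)] at hsum
    have := Bool.toNat_le (N r (e (.inl (![0, 0, 0, 0, 1, 1, 1, 2, 2, 3] k))) &&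
      N r (e (.inl (![1, 2, 3, 4, 2, 3, 4, 3, 4, 4] k))))
    omega
  rw [Bool.and_eq_true] at hN
  refine ⟨s, hs, eq_pairInc_of_sum k (fun j => N s (e (.inl j))) ?_ hN.1 hN.2⟩
  have := h.inter s r hs
  rw [← e.sum_comp, Fintype.sum_sum_type] at this
  simpa [he, he'] using this

/-- Every biplane of order three has one of the two normal forms. -/
theorem IsBiplane.exists_normalForm (h : IsBiplane N) :
    ∃ (s : Bool) (R : Option (Fin 10) ≃ Fin 11) (e : Fin 5 ⊕ Fin 6 ≃ Fin 11),
      ∀ o x, N (R o) (e x) = normalForm s o x := by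
  obtain ⟨e, he, he'⟩ := h.exists_pointEquiv 0
  choose ρ hρ hρN using h.exists_row 0 e he he'
  have hinj : Function.Injective (fun o : Option (Fin 10) => o.elim 0 ρ) := by
    rintro (_ | k) (_ | k') hk
    · rfl
    · exact absurd hk.symm (hρ k')
    · exact absurd hk (hρ k)
    · refine congrArg some (pairInc_injective _ _ fun j => ?_)
      rw [← hρN, ← hρN]
      exact congrArg (fun r => N r _) hk
  let R : Option (Fin 10) ≃ Fin 11 := Equiv.ofBijective _
    ((Fintype.bijective_iff_injective_and_card _).2 ⟨hinj, by simp⟩)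
  have hR0 : R none = 0 := rfl
  have hR : ∀ k, R (some k) = ρ k := fun k => rfl
  have hsum : ∀ x y, x ≠ y → (N 0 (e x) && N 0 (e y)).toNat +
      ∑ k, (N (ρ k) (e x) && N (ρ k) (e y)).toNat = 2 := by
    intro x y hxy
    have := h.inter_col (e.injective.ne hxy)
    rwa [← R.sum_comp, Fintype.sum_option] at this
  have hpent : ∀ p, ∃ s q, (fun k => N (ρ k) (e (.inr p))) = pentagon s q := by
    intro p
    refine eq_pentagon _ fun j => ?_
    have := hsum (.inr p) (.inl j) (by simp)
    simpa [he', hρN] using this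
  choose s q hsq using hpent
  have hpair : ∀ p p', p ≠ p' → s p = s p' ∧ q p ≠ q p' := by
    intro p p' hp
    refine pentagon_inter _ _ _ _ ?_
    rw [← hsq, ← hsq]
    have := hsum (.inr p) (.inr p') (by simpa using hp)
    simpa [he'] using this
  have hs : ∀ p, s p = s 0 := fun p => by
    by_cases hp : p = 0
    · rw [hp]
    · exact (hpair p 0 hp).1
  let π : Fin 6 ≃ Fin 6 := Equiv.ofBijective q (Finite.injective_iff_bijective.1
    fun p p' hp => by_contra fun H => (hpair p p' H).2 hp)
  refine ⟨s 0, R, (Equiv.sumCongr (Equiv.refl _) π.symm).trans e, ?_⟩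
  rintro (_ | k) (j | p)
  · simpa [hR0, normalForm] using he j
  · simpa [hR0, normalForm] using he' _
  · simpa [hR, normalForm] using hρN k j
  · have h1 := congrFun (hsq (π.symm p)) k
    have h2 : q (π.symm p) = p := π.apply_symm_apply p
    simpa [hR, hs, h2, normalForm] using h1

open NT

theorem normalForm_eq_hadRow (s : Bool) :
    ∃ (R : Option (Fin 10) ≃ ZMod 11) (e : Fin 5 ⊕ Fin 6 ≃ Fin 11),
      ∀ o x, normalForm s o x = decide (hadRow (R o) (e x) = 0) := by
  let R : Bool → Option (Fin 10) → ZMod 11 := fun s o => o.elim 0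
    (bif s then ![7, 5, 3, 6, 10, 4, 9, 8, 1, 2] else ![7, 5, 6, 3, 10, 9, 4, 1, 8, 2])
  let e : Bool → Fin 5 ⊕ Fin 6 → Fin 11 := fun s => bif s then
    Sum.elim ![2, 6, 7, 10, 8] ![5, 1, 0, 3, 9, 4] else
    Sum.elim ![2, 6, 7, 8, 10] ![5, 0, 1, 9, 3, 4]
  have hR : ∀ s, Function.Injective (R s) := by decide +kernel
  have he : ∀ s, Function.Injective (e s) := by decide +kernel
  have key : ∀ s o x, normalForm s o x = decide (hadRow (R s o) (e s x) = 0) := by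
    decide +kernel
  exact ⟨Equiv.ofBijective _ ((Fintype.bijective_iff_injective_and_card _).2 ⟨hR s, by simp⟩),
    Equiv.ofBijective _ ((Fintype.bijective_iff_injective_and_card _).2 ⟨he s, by simp⟩), key s⟩

/-- Words whose zero sets form a biplane are the words `hadRow b`, up to permuting entries. -/
theorem IsBiplane.exists_perm_range_eq {w : Fin 11 → V 11 2}
    (h : IsBiplane fun r k => decide (w r k = 0)) :
    ∃ σ : Equiv.Perm (Fin 11), Set.range (fun r i => w r (σ i)) = Set.range hadRow := by
  obtain ⟨s, R, e, hN⟩ := h.exists_normalForm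
  obtain ⟨R', e', hN'⟩ := normalForm_eq_hadRow s
  have hfin : ∀ a b : Fin 2, decide (a = 0) = decide (b = 0) → a = b := by decide
  have key : ∀ o i, w (R o) (e (e'.symm i)) = hadRow (R' o) i := fun o i => by
    have := (hN o (e'.symm i)).trans (hN' o (e'.symm i))
    rw [e'.apply_symm_apply] at this
    exact hfin _ _ this
  refine ⟨e'.symm.trans e, ?_⟩
  rw [← R.surjective.range_comp, ← R'.surjective.range_comp]
  exact congrArg Set.range (funext fun o => funext fun i => key o i)

end Biplane

namespace BinaryCode

open NT Finset

theorem hammingDist_eq_sum {n : ℕ} (a b : V n 2) :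
    hammingDist a b = ∑ i, if a i ≠ b i then 1 else 0 := by
  rw [hammingDist, card_filter]

/-- The vertex obtained from `c` by changing the entry `i`. -/
def flip {n : ℕ} (c : V n 2) (i : Fin n) : V n 2 := Function.update c i (c i + 1)

theorem hammingDist_flip {n : ℕ} (c b : V n 2) (i : Fin n) :
    hammingDist (flip c i) b + (if c i ≠ b i then 1 else 0) =
      hammingDist c b + if c i = b i then 1 else 0 := by
  have h : ∀ x y : Fin 2, (if x + 1 ≠ y then 1 else 0) + (if x ≠ y then 1 else 0) =
      (if x ≠ y then 1 else 0) + if x = y then 1 else 0 := by decide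
  have h' : ∑ j ∈ {i}ᶜ, (if flip c i j ≠ b j then 1 else 0) =
      ∑ j ∈ {i}ᶜ, if c j ≠ b j then 1 else 0 :=
    sum_congr rfl fun j hj => by
      have : j ≠ i := by simpa using hj
      rw [flip, Function.update_of_ne this]
  have := h (c i) (b i)
  rw [hammingDist_eq_sum, hammingDist_eq_sum, Fintype.sum_eq_add_sum_compl i, h',
    Fintype.sum_eq_add_sum_compl i (fun j => if c j ≠ b j then 1 else 0)]
  simp only [flip, Function.update_self]
  omega

/-- The number of entries in which both `a` and `b` differ from `c`. -/
def inter {n : ℕ} (c a b : V n 2) : ℕ := ∑ i, if c i ≠ a i ∧ c i ≠ b i then 1 else 0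

theorem hammingDist_add_inter {n : ℕ} (c a b : V n 2) :
    hammingDist a b + 2 * inter c a b = hammingDist c a + hammingDist c b := by
  have h : ∀ x y z : Fin 2, (if y ≠ z then 1 else 0) + 2 * (if x ≠ y ∧ x ≠ z then 1 else 0) =
      (if x ≠ y then 1 else 0) + if x ≠ z then 1 else 0 := by decide
  simp only [hammingDist_eq_sum, inter, mul_sum, ← sum_add_distrib]
  exact sum_congr rfl fun i _ => h _ _ _

/-- The antipode of a binary word. -/
def compl {n : ℕ} (a : V n 2) : V n 2 := fun i => 1 - a i

theorem hammingDist_compl {n : ℕ} (a b : V n 2) :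
    hammingDist (compl a) b + hammingDist a b = n := by
  have h : ∀ x y : Fin 2, (if 1 - x ≠ y then 1 else 0) + (if x ≠ y then 1 else 0) = 1 := by
    decide
  have h' : ∀ i, (if compl a i ≠ b i then 1 else 0) + (if a i ≠ b i then 1 else 0) = 1 :=
    fun i => h (a i) (b i)
  rw [hammingDist_eq_sum, hammingDist_eq_sum, ← sum_add_distrib,
    sum_congr rfl fun i _ => h' i]
  simp

theorem eq_compl_of_hammingDist {n : ℕ} {a b : V n 2} (h : hammingDist a b = n) :
    b = compl a := by
  have := hammingDist_compl a b
  exact (hammingDist_eq_zero.1 (by omega)).symm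

/-- The codewords at distance `w` from `c`. -/
abbrev layer {n : ℕ} (C : Finset (V n 2)) (c : V n 2) (w : ℕ) : Finset (V n 2) :=
  {b ∈ C | hammingDist c b = w}

/-- The number of codewords at distance `w` from `c` which differ from `c` in the entry `i`. -/
abbrev replication {n : ℕ} (C : Finset (V n 2)) (c : V n 2) (w : ℕ) (i : Fin n) : ℕ :=
  #{b ∈ layer C c w | c i ≠ b i}

/-- A binary code of length 11 with minimum distance at least five which is 1-regular, in terms
of the numbers of codewords at given distance from a codeword or its neighbours. -/
structure IsOneRegular (C : Finset (V 11 2)) : Prop where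
  card_layer : ∀ a ∈ C, ∀ b ∈ C, ∀ k ≤ 11, #(layer C a k) = #(layer C b k)
  card_layer_flip : ∀ a ∈ C, ∀ i j, ∀ k ≤ 11,
    #(layer C (flip a i) k) = #(layer C (flip a j) k)
  five_le : ∀ a ∈ C, ∀ b ∈ C, a ≠ b → 5 ≤ hammingDist a b

theorem card_layer_eq_replication_add {n : ℕ} (C : Finset (V n 2)) (c : V n 2) (w : ℕ)
    (i : Fin n) : #(layer C c w) = replication C c w i + #{b ∈ layer C c w | c i = b i} := by
  have := card_filter_add_card_filter_not (s := layer C c w) (fun b => c i ≠ b i)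
  simpa using this.symm

theorem card_layer_flip_succ {n : ℕ} (C : Finset (V n 2)) (c : V n 2) (w : ℕ) (i : Fin n) :
    #(layer C (flip c i) (w + 1)) =
      replication C c (w + 2) i + #{b ∈ layer C c w | c i = b i} := by
  rw [← card_filter_add_card_filter_not (s := layer C (flip c i) (w + 1)) (fun b => c i ≠ b i)]
  simp only [replication, layer, filter_filter]
  refine congrArg₂ (· + ·) (congrArg card (filter_congr fun b _ => ?_))
    (congrArg card (filter_congr fun b _ => ?_))
  · have := hammingDist_flip c b i
    by_cases hb : c i = b i
    · simp [hb]
    · rw [if_pos hb, if_neg hb] at this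
      exact and_congr_left fun _ => by omega
  · have := hammingDist_flip c b i
    by_cases hb : c i = b i
    · rw [if_neg (not_not.2 hb), if_pos hb] at this
      rw [ne_eq, not_not]
      exact and_congr_left fun _ => by omega
    · simp [hb]

theorem replication_eq_sum {n : ℕ} (C : Finset (V n 2)) (c : V n 2) (w : ℕ) (i : Fin n) :
    replication C c w i = ∑ b ∈ layer C c w, if c i ≠ b i then 1 else 0 :=
  card_filter _ _

theorem sum_replication {n : ℕ} (C : Finset (V n 2)) (c : V n 2) (w : ℕ) :
    ∑ i, replication C c w i = w * #(layer C c w) := by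
  simp only [replication_eq_sum]
  rw [sum_comm, sum_congr rfl (g := fun _ => w), sum_const, smul_eq_mul, mul_comm]
  intro b hb
  rw [← hammingDist_eq_sum]
  exact (mem_filter.1 hb).2

theorem sum_inter {n : ℕ} (C : Finset (V n 2)) (c : V n 2) (w : ℕ) (a : V n 2) :
    ∑ i, (if c i ≠ a i then replication C c w i else 0) = ∑ b ∈ layer C c w, inter c a b := by
  simp only [replication_eq_sum, inter]
  rw [sum_comm]
  refine sum_congr rfl fun i _ => ?_
  by_cases h : c i = a i <;> simp [h]

namespace IsOneRegular

variable {C : Finset (V 11 2)} {a b c : V 11 2}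

theorem replication_eq (h : IsOneRegular C) (hc : c ∈ C) (i j : Fin 11) {w : ℕ} (hw : w ≤ 11) :
    replication C c w i = replication C c w j := by
  induction w using Nat.strong_induction_on with
  | _ w ih =>
    by_cases hw4 : w < 5
    · have : ∀ i, replication C c w i = 0 := by
        intro i
        rw [replication, card_eq_zero, filter_filter, filter_eq_empty_iff]
        rintro b hb ⟨hd, hi⟩
        have := h.five_le c hc b hb (fun e => hi (congrFun e i))
        omega
      rw [this, this]
    · obtain ⟨v, rfl⟩ : ∃ v, w = v + 2 := ⟨w - 2, by omega⟩
      have h1 := card_layer_flip_succ C c v i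
      have h2 := card_layer_flip_succ C c v j
      have h3 := card_layer_eq_replication_add C c v i
      have h4 := card_layer_eq_replication_add C c v j
      have h5 := ih v (by omega) (by omega)
      have h6 := h.card_layer_flip c hc i j (v + 1) (by omega)
      omega

theorem eleven_mul_replication (h : IsOneRegular C) (hc : c ∈ C) (i : Fin 11) {w : ℕ}
    (hw : w ≤ 11) : 11 * replication C c w i = w * #(layer C c w) := by
  rw [← sum_replication, sum_congr rfl fun j _ => h.replication_eq hc j i hw]
  simp

theorem card_layer_eq (h : IsOneRegular C) (hc : c ∈ C) {w : ℕ} (h5 : 5 ≤ w) (h10 : w ≤ 10)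
    (hne : (layer C c w).Nonempty) : #(layer C c w) = 11 ∧ (w = 5 ∨ w = 6) := by
  obtain ⟨a, ha⟩ := hne
  obtain ⟨haC, haw⟩ := mem_filter.1 ha
  have hr := h.eleven_mul_replication hc 0 (w := w) (by omega)
  have h1 : ∑ i, (if c i ≠ a i then replication C c w i else 0) = w * replication C c w 0 := by
    have hsum := hammingDist_eq_sum c a
    rw [haw] at hsum
    conv_rhs => arg 1; rw [hsum]
    rw [sum_mul]
    refine sum_congr rfl fun i _ => ?_
    rw [h.replication_eq hc i 0 (by omega)]
    simp
  rw [sum_inter, ← add_sum_erase _ _ ha] at h1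
  have h2 : ∑ b ∈ (layer C c w).erase a, inter c a b ≤ (#(layer C c w) - 1) * (w - 3) := by
    rw [← card_erase_of_mem ha, ← smul_eq_mul]
    refine sum_le_card_nsmul _ _ _ fun b hb => ?_
    obtain ⟨hba, hb⟩ := mem_erase.1 hb
    obtain ⟨hbC, hbw⟩ := mem_filter.1 hb
    have := h.five_le a haC b hbC hba.symm
    have := hammingDist_add_inter c a b
    omega
  have h3 : inter c a a = w := by
    have := hammingDist_add_inter c a a
    rw [hammingDist_self] at this
    omega
  have h4 : 0 < #(layer C c w) := card_pos.2 ⟨a, ha⟩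
  generalize #(layer C c w) = A at *
  interval_cases w <;> omega

theorem hammingDist_cases (h : IsOneRegular C) (ha : a ∈ C) (hb : b ∈ C) (hab : a ≠ b) :
    hammingDist a b = 5 ∨ hammingDist a b = 6 ∨ hammingDist a b = 11 := by
  have h5 := h.five_le a ha b hb hab
  have h11 : hammingDist a b ≤ 11 := by simpa using hammingDist_le_card_fintype (x := a) (y := b)
  by_cases h' : hammingDist a b = 11
  · exact .inr (.inr h')
  · have := (h.card_layer_eq ha h5 (by omega) ⟨b, mem_filter.2 ⟨hb, rfl⟩⟩).2
    omega

/-- The words at distance six from a codeword form a biplane. -/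
theorem exists_perm (h : IsOneRegular C) (hc : c ∈ C) (hne : (layer C c 6).Nonempty) :
    ∃ σ : Equiv.Perm (Fin 11),
      (fun (b : V 11 2) i => b (σ i) + c (σ i)) '' (layer C c 6) = Set.range hadRow := by
  have hA := (h.card_layer_eq hc (by omega) (by omega) hne).1
  have hr : ∀ i, replication C c 6 i = 6 := fun i => by
    have := h.eleven_mul_replication hc i (w := 6) (by omega)
    omega
  let e : Fin 11 ≃ layer C c 6 := ((layer C c 6).equivFinOfCardEq hA).symm
  have heC : ∀ r, (e r : V 11 2) ∈ C := fun r => (mem_filter.1 (e r).2).1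
  have hed : ∀ r, hammingDist c (e r) = 6 := fun r => (mem_filter.1 (e r).2).2
  have hsum : ∀ r s, 2 * ∑ k, (decide ((e r : V 11 2) k + c k = 0) &&
      decide ((e s : V 11 2) k + c k = 0)).toNat + hammingDist (e r : V 11 2) (e s) + 12
        = 22 := by
    intro r s
    have hfin : ∀ x y z : Fin 2, 2 * (decide (x + z = 0) && decide (y + z = 0)).toNat +
        (if x ≠ y then 1 else 0) + (if z ≠ x then 1 else 0) + (if z ≠ y then 1 else 0) = 2 := by
      decide
    have : 2 * ∑ k, (decide ((e r : V 11 2) k + c k = 0) &&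
        decide ((e s : V 11 2) k + c k = 0)).toNat + hammingDist (e r : V 11 2) (e s)
          + hammingDist c (e r) + hammingDist c (e s) = 22 := by
      simp only [hammingDist_eq_sum, mul_sum, ← sum_add_distrib, hfin]
      simp
    rw [hed, hed] at this
    omega
  have hbi : Biplane.IsBiplane fun r k => decide ((e r : V 11 2) k + c k = 0) := by
    refine ⟨fun r => ?_, fun k => ?_, fun r s hrs => ?_⟩
    · have := hsum r r
      simp only [Bool.and_self, hammingDist_self] at this
      omega
    · have hfin : ∀ x z : Fin 2, (decide (x + z = 0)).toNat + (if z ≠ x then 1 else 0) = 1 := by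
        decide
      have h1 : ∑ r, (if c k ≠ (e r : V 11 2) k then 1 else 0) = 6 := by
        rw [e.sum_comp (fun b => if c k ≠ (b : V 11 2) k then 1 else 0)]
        refine (sum_coe_sort (layer C c 6) (fun b => if c k ≠ b k then 1 else 0)).trans ?_
        rw [← replication_eq_sum, hr]
      have h2 : ∑ r, ((decide ((e r : V 11 2) k + c k = 0)).toNat +
          (if c k ≠ (e r : V 11 2) k then 1 else 0)) = 11 := by
        simp only [hfin]
        simp
      rw [sum_add_distrib] at h2
      omega
    · have hne : (e r : V 11 2) ≠ e s := fun H => hrs (e.injective (Subtype.ext H))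
      have h1 := h.hammingDist_cases (heC r) (heC s) hne
      have h2 := hsum r s
      show ∑ k, (decide ((e r : V 11 2) k + c k = 0) &&
        decide ((e s : V 11 2) k + c k = 0)).toNat = 2
      omega
  obtain ⟨σ, hσ⟩ := Biplane.IsBiplane.exists_perm_range_eq
    (w := fun r k => (e r : V 11 2) k + c k) hbi
  refine ⟨σ, ?_⟩
  rw [← hσ]
  ext x
  constructor
  · rintro ⟨b, hb, rfl⟩
    exact ⟨e.symm ⟨b, hb⟩, by simp⟩
  · rintro ⟨r, rfl⟩
    exact ⟨e r, (e r).2, rfl⟩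

end IsOneRegular

/-- Translation by `c` followed by the entry permutation `σ⁻¹`. -/
def translate {n : ℕ} (c : V n 2) (σ : Equiv.Perm (Fin n)) : Equiv.Perm (V n 2) :=
  hAut n 2 (fun i => Equiv.addRight (c (σ i))) σ⁻¹

theorem translate_apply {n : ℕ} (c : V n 2) (σ : Equiv.Perm (Fin n)) (b : V n 2) :
    translate c σ b = fun i => b (σ i) + c (σ i) := by
  ext i
  simp [translate, hAut]

theorem translate_mem {n : ℕ} (c : V n 2) (σ : Equiv.Perm (Fin n)) :
    translate c σ ∈ HammingAut n 2 := ⟨_, _, rfl⟩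

theorem translate_self {n : ℕ} (c : V n 2) (σ : Equiv.Perm (Fin n)) :
    translate c σ c = fun _ => 0 := by
  rw [translate_apply]
  have : ∀ x : Fin 2, x + x = 0 := by decide
  exact funext fun i => this _

theorem translate_compl {n : ℕ} (c b : V n 2) (σ : Equiv.Perm (Fin n)) :
    translate c σ (compl b) = compl (translate c σ b) := by
  rw [translate_apply, translate_apply]
  have : ∀ x y : Fin 2, 1 - x + y = 1 - (x + y) := by decide
  exact funext fun i => this _ _

theorem compl_compl {n : ℕ} (b : V n 2) : compl (compl b) = b := by
  have : ∀ x : Fin 2, 1 - (1 - x) = x := by decide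
  exact funext fun i => this _

theorem repCode_eq (n : ℕ) : RepCode n 2 = {fun _ => 0, fun _ => 1} := by
  ext x
  simp only [RepCode, Set.mem_ofPred_eq, Fin.exists_fin_two, Set.mem_insert_iff,
    Set.mem_singleton_iff]

theorem minDist_eq {m q : ℕ} {C : Set (V m q)} {a b : V m q} (ha : a ∈ C) (hb : b ∈ C)
    (hab : a ≠ b) (h : ∀ x ∈ C, ∀ y ∈ C, x ≠ y → hammingDist a b ≤ hammingDist x y) :
    minDist m q C = hammingDist a b := by
  refine le_antisymm (Nat.sInf_le ⟨a, ha, b, hb, hab, rfl⟩)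
    (le_csInf ⟨_, a, ha, b, hb, hab, rfl⟩ ?_)
  rintro d ⟨x, hx, y, hy, hxy, rfl⟩
  exact h x hx y hy hxy

theorem mem_cell_zero {m q : ℕ} {C : Set (V m q)} {a : V m q} (ha : a ∈ C) :
    a ∈ cell m q C 0 :=
  Nat.le_zero.1 (Nat.sInf_le ⟨a, ha, hammingDist_self a⟩)

theorem mem_cell_one {m q : ℕ} {C : Set (V m q)} {a b : V m q} (ha : a ∉ C) (hb : b ∈ C)
    (hab : hammingDist a b = 1) : a ∈ cell m q C 1 := by
  refine le_antisymm (Nat.sInf_le ⟨b, hb, hab⟩) (le_csInf ⟨1, b, hb, hab⟩ ?_)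
  rintro d ⟨x, hx, rfl⟩
  exact hammingDist_pos.2 fun e => ha (e ▸ hx)

theorem isOneRegular {C : Finset (V 11 2)} (hreg : SRegular 11 2 C 1)
    (hδ : 5 ≤ minDist 11 2 C) : IsOneRegular C := by
  have h5 : ∀ a ∈ C, ∀ b ∈ C, a ≠ b → 5 ≤ hammingDist a b := fun a ha b hb hab =>
    hδ.trans (Nat.sInf_le ⟨a, ha, b, hb, hab, rfl⟩)
  have hlayer : ∀ a k, {b ∈ (C : Set (V 11 2)) | hammingDist a b = k}.ncard =
      #(layer C a k) := fun a k => by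
    rw [← Set.ncard_coe_finset]
    congr 1
    ext b
    simp
  have hflip : ∀ a ∈ C, ∀ i, flip a i ∈ cell 11 2 C 1 := fun a ha i => by
    have hd : hammingDist (flip a i) a = 1 := by
      simpa using hammingDist_flip a a i
    refine mem_cell_one (fun hf => ?_) ha hd
    have := h5 _ hf a ha (hammingDist_pos.1 (by omega))
    omega
  refine ⟨fun a ha b hb k hk => ?_, fun a ha i j k hk => ?_, h5⟩
  · rw [← hlayer, ← hlayer]
    exact hreg 0 (by omega) k hk a (mem_cell_zero ha) b (mem_cell_zero hb)
  · rw [← hlayer, ← hlayer]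
    exact hreg 1 le_rfl k hk _ (hflip a ha i) _ (hflip a ha j)

namespace IsOneRegular

variable {C : Finset (V 11 2)} {c : V 11 2}

theorem compl_mem (h : IsOneRegular C) (hc : c ∈ C) (hc' : compl c ∈ C) :
    ∀ b ∈ C, compl b ∈ C := by
  intro b hb
  have hd : hammingDist c (compl c) = 11 := by
    have := hammingDist_compl c c
    rw [hammingDist_self] at this
    rw [hammingDist_comm]
    omega
  have hpos : 0 < #(layer C b 11) := by
    rw [h.card_layer b hb c hc 11 le_rfl]
    exact card_pos.2 ⟨compl c, mem_filter.2 ⟨hc', hd⟩⟩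
  obtain ⟨x, hx⟩ := card_pos.1 hpos
  obtain ⟨hxC, hxd⟩ := mem_filter.1 hx
  rwa [← eq_compl_of_hammingDist hxd]

theorem equiv_repCode (hc : c ∈ C) (hc' : compl c ∈ C)
    (hC : ∀ b ∈ C, b = c ∨ b = compl c) :
    minDist 11 2 C = 11 ∧ CodeEquiv 11 2 C (RepCode 11 2) := by
  have hCeq : (C : Set (V 11 2)) = {c, compl c} := by
    ext b
    simp only [mem_coe, Set.mem_insert_iff, Set.mem_singleton_iff]
    exact ⟨hC b, by rintro (rfl | rfl) <;> assumption⟩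
  have hd : hammingDist (compl c) c = 11 := by
    simpa using hammingDist_compl c c
  refine ⟨?_, translate c 1, translate_mem _ _, ?_⟩
  · rw [minDist_eq (a := compl c) (b := c) hc' hc (hammingDist_pos.1 (by omega)), hd]
    intro x hx y hy hxy
    rw [hd]
    rcases hC x hx with rfl | rfl <;> rcases hC y hy with rfl | rfl
    · exact absurd rfl hxy
    · rw [hammingDist_comm, hd]
    · rw [hd]
    · exact absurd rfl hxy
  · rw [hCeq, Set.image_pair, translate_compl, translate_self, repCode_eq]
    rfl

theorem equiv_pHad (h : IsOneRegular C) (hc : c ∈ C) (hc' : compl c ∈ C)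
    (hne : (layer C c 6).Nonempty) :
    minDist 11 2 C = 5 ∧ CodeEquiv 11 2 C PHad := by
  have hcompl := h.compl_mem hc hc'
  obtain ⟨a, ha⟩ := hne
  obtain ⟨haC, had⟩ := mem_filter.1 ha
  obtain ⟨σ, hσ⟩ := h.exists_perm hc ⟨a, ha⟩
  have hd : hammingDist (compl c) a = 5 := by
    have := hammingDist_compl c a
    omega
  have hCeq : (C : Set (V 11 2)) = {c, compl c} ∪ (layer C c 6 : Set (V 11 2)) ∪
      compl '' (layer C c 6 : Set (V 11 2)) := by
    ext b
    constructor
    · intro hb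
      by_cases hcb : c = b
      · exact .inl (.inl (.inl hcb.symm))
      · rcases h.hammingDist_cases hc hb hcb with hd | hd | hd
        · refine .inr ⟨compl b, ?_, compl_compl b⟩
          refine mem_coe.2 (mem_filter.2 ⟨hcompl b hb, ?_⟩)
          have := hammingDist_compl b c
          rw [hammingDist_comm b] at this
          rw [hammingDist_comm]
          omega
        · exact .inl (.inr (mem_coe.2 (mem_filter.2 ⟨hb, hd⟩)))
        · exact .inl (.inl (.inr (eq_compl_of_hammingDist hd)))
    · rintro (((rfl | rfl) | hb) | ⟨x, hx, rfl⟩)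
      · exact hc
      · exact hc'
      · exact (mem_filter.1 (mem_coe.1 hb)).1
      · exact hcompl x (mem_filter.1 (mem_coe.1 hx)).1
  refine ⟨?_, translate c σ, translate_mem _ _, ?_⟩
  · rw [minDist_eq (a := compl c) (b := a) hc' haC (hammingDist_pos.1 (by omega)), hd]
    rw [hd]
    exact h.five_le
  · have himg : translate c σ '' (layer C c 6) = Set.range hadRow := by
      rw [← hσ]
      exact Set.image_congr fun b _ => translate_apply c σ b
    have himg' : translate c σ '' (compl '' (layer C c 6)) =
        Set.range fun b => compl (hadRow b) := by
      rw [Set.image_image]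
      simp only [translate_compl]
      rw [← Set.image_image compl (translate c σ), himg, ← Set.range_comp]
      rfl
    rw [hCeq, Set.image_union, Set.image_union, Set.image_pair, translate_compl, translate_self,
      himg, himg']
    rfl

theorem layer_five_eq_empty (h : IsOneRegular C) (hc : c ∈ C)
    (hno : ∀ a ∈ C, ∀ b ∈ C, hammingDist a b ≠ 11) : layer C c 5 = ∅ := by
  by_contra hne
  obtain ⟨a, ha⟩ := nonempty_iff_ne_empty.2 hne
  have h11 := (h.card_layer_eq hc (by omega) (by omega) ⟨a, ha⟩).1
  obtain ⟨haC, had⟩ := mem_filter.1 ha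
  have heq : layer C a 6 = (layer C c 5).erase a := by
    ext b
    simp only [mem_filter, mem_erase]
    have hpar := hammingDist_add_inter c a b
    constructor
    · rintro ⟨hb, hd⟩
      have hcb : c ≠ b := by
        rintro rfl
        rw [hammingDist_comm] at hd
        omega
      have := h.hammingDist_cases hc hb hcb
      have := hno c hc b hb
      exact ⟨fun e => by simp [e] at hd, hb, by omega⟩
    · rintro ⟨hba, hb, hd⟩
      have := h.hammingDist_cases haC hb hba.symm
      exact ⟨hb, by omega⟩
  have h10 : #(layer C a 6) = 10 := by
    rw [heq, card_erase_of_mem ha, h11]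
  have := (h.card_layer_eq haC (w := 6) (by omega) (by omega) (card_pos.1 (by omega))).1
  omega

theorem equiv_eSub (h : IsOneRegular C) (hc : c ∈ C) (hcard : 2 ≤ #C)
    (hno : ∀ a ∈ C, ∀ b ∈ C, hammingDist a b ≠ 11) :
    minDist 11 2 C = 6 ∧ CodeEquiv 11 2 C ESub := by
  have h6 : ∀ a ∈ C, ∀ b ∈ C, a ≠ b → hammingDist a b = 6 := by
    intro a ha b hb hab
    rcases h.hammingDist_cases ha hb hab with hd | hd | hd
    · have hb' : b ∈ layer C a 5 := mem_filter.2 ⟨hb, hd⟩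
      simp [h.layer_five_eq_empty ha hno] at hb'
    · exact hd
    · exact absurd hd (hno a ha b hb)
  obtain ⟨a, haC, hac⟩ := exists_mem_ne (by omega : 1 < #C) c
  have had := h6 c hc a haC hac.symm
  obtain ⟨σ, hσ⟩ := h.exists_perm hc ⟨a, mem_filter.2 ⟨haC, had⟩⟩
  have hCeq : (C : Set (V 11 2)) = insert c (layer C c 6 : Set (V 11 2)) := by
    ext b
    constructor
    · intro hb
      by_cases hcb : c = b
      · exact .inl hcb.symm
      · exact .inr (mem_coe.2 (mem_filter.2 ⟨hb, h6 c hc b hb hcb⟩))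
    · rintro (rfl | hb)
      · exact hc
      · exact (mem_filter.1 (mem_coe.1 hb)).1
  refine ⟨?_, translate c σ, translate_mem _ _, ?_⟩
  · rw [minDist_eq (a := c) (b := a) hc haC hac.symm, had]
    intro x hx y hy hxy
    rw [had, h6 x hx y hy hxy]
  · have himg : translate c σ '' (layer C c 6) = Set.range hadRow := by
      rw [← hσ]
      exact Set.image_congr fun b _ => translate_apply c σ b
    rw [hCeq, Set.image_insert_eq, translate_self, himg]
    rfl

theorem classification (h : IsOneRegular C) (hcard : 2 ≤ #C) :
    (minDist 11 2 C = 11 ∧ CodeEquiv 11 2 C (RepCode 11 2)) ∨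
    (minDist 11 2 C = 5 ∧ CodeEquiv 11 2 C PHad) ∨
    (minDist 11 2 C = 6 ∧ CodeEquiv 11 2 C ESub) := by
  by_cases hno : ∀ a ∈ C, ∀ b ∈ C, hammingDist a b ≠ 11
  · obtain ⟨c, hc⟩ := card_pos.1 (by omega : 0 < #C)
    exact .inr (.inr (h.equiv_eSub hc hcard hno))
  push Not at hno
  obtain ⟨c, hc, b, hb, hd⟩ := hno
  have hc' : compl c ∈ C := eq_compl_of_hammingDist hd ▸ hb
  by_cases hne : (layer C c 6).Nonempty
  · exact .inr (.inl (h.equiv_pHad hc hc' hne))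
  refine .inl (equiv_repCode hc hc' fun x hx => ?_)
  by_contra! hx'
  refine hne ?_
  rcases h.hammingDist_cases hc hx hx'.1.symm with hd | hd | hd
  · refine ⟨compl x, mem_filter.2 ⟨h.compl_mem hc hc' x hx, ?_⟩⟩
    have := hammingDist_compl x c
    rw [hammingDist_comm x] at this
    rw [hammingDist_comm]
    omega
  · exact ⟨x, mem_filter.2 ⟨hx, hd⟩⟩
  · exact absurd (eq_compl_of_hammingDist hd) hx'.2

end IsOneRegular

end BinaryCode

open NT Equiv in
/-- Proposition 4.3: a 2-regular code in `H(11,2)` with `δ ≥ 5` and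
`|C| ≥ 2` is equivalent to the binary repetition code (`δ = 11`), the punctured
Hadamard code `P` (`δ = 5`), or the even weight subcode `E` of `P` (`δ = 6`). -/
theorem stmt_16 (C : Set (V 11 2)) (hreg : SRegular 11 2 C 2)
    (hδ : 5 ≤ minDist 11 2 C) (hC : 2 ≤ C.ncard) :
    (minDist 11 2 C = 11 ∧ CodeEquiv 11 2 C (RepCode 11 2)) ∨
    (minDist 11 2 C = 5 ∧ CodeEquiv 11 2 C PHad) ∨
    (minDist 11 2 C = 6 ∧ CodeEquiv 11 2 C ESub) := by
  lift C to Finset (V 11 2) using C.toFinite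
  rw [Set.ncard_coe_finset] at hC
  exact (BinaryCode.isOneRegular (fun i hi => hreg i (hi.trans one_le_two)) hδ).classification hC
end
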